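/- Let G be a separated single-crossing topological multigraph on n vertices with degree sequence d₁, …, dₙ and crossing number cr(G). Define the bisection width b(G) as the minimum number of edges whose deletion from G admits a partition of the vertex set V = V₁ ∪ V₂ with |V₁|, |V₂| ≤ 4n/5 such that no remaining edge joins a vertex of V₁ to a vertex of V₂ and, for i = 1, 2, the topological multigraph formed by V_i together with the remaining edges joining two vertices of V_i is a separated single-crossing topological multigraph. Then b(G) ≤ 22·√(cr(G) + Σᵢ dᵢ² + n). -/

import Mathlib

open Set

/-- A topological multigraph: a finite vertex set `V ⊂ ℝ²` together with a finite family of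
edges, each represented by a continuous injective arc `[0,1] → ℝ²` whose endpoints are two
distinct vertices and whose interior avoids all vertices. -/
structure TopMultigraph where
  V : Finset (ℝ × ℝ)
  ι : Type
  fintype_ι : Fintype ι
  arc : ι → unitInterval → ℝ × ℝ
  continuous_arc : ∀ e, Continuous (arc e)
  injective_arc : ∀ e, Function.Injective (arc e)
  source_mem : ∀ e, arc e 0 ∈ V
  target_mem : ∀ e, arc e 1 ∈ V
  ends_ne : ∀ e, arc e 0 ≠ arc e 1
  interior_avoids : ∀ e (t : unitInterval), t ≠ 0 → t ≠ 1 → arc e t ∉ V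

namespace TopMultigraph

variable (G : TopMultigraph)

instance : Fintype G.ι := G.fintype_ι

/-- The number of edges of `G`. -/
noncomputable def edgeCount : ℕ := Nat.card G.ι

/-- The interior of an edge: the image of the open interval `(0,1)`. -/
def arcInterior (e : G.ι) : Set (ℝ × ℝ) :=
  G.arc e '' {t : unitInterval | t ≠ 0 ∧ t ≠ 1}

/-- The set of the two endpoints of an edge. -/
def endpoints (e : G.ι) : Set (ℝ × ℝ) := {G.arc e 0, G.arc e 1}

/-- Two distinct edges are parallel if they join the same pair of vertices. -/
def Parallel (e f : G.ι) : Prop := e ≠ f ∧ G.endpoints e = G.endpoints f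

/-- Two edges are independent if they share no endpoint. -/
def Independent (e f : G.ι) : Prop := Disjoint (G.endpoints e) (G.endpoints f)

/-- Two edges cross if their open arcs share a common point. -/
def Cross (e f : G.ι) : Prop := (G.arcInterior e ∩ G.arcInterior f).Nonempty

/-- `G` is single-crossing if any two distinct edges share at most one common interior point. -/
def SingleCrossing : Prop :=
  ∀ e f : G.ι, e ≠ f → (G.arcInterior e ∩ G.arcInterior f).Subsingleton

/-- An edge `e` joins `u` and `v` if its endpoint set is `{u, v}`. -/
def Joins (e : G.ι) (u v : ℝ × ℝ) : Prop := G.endpoints e = {u, v}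

/-- The union of the images of all edges of `G` joining `u` and `v`. -/
def pairUnion (u v : ℝ × ℝ) : Set (ℝ × ℝ) :=
  ⋃ e ∈ {e : G.ι | G.Joins e u v}, Set.range (G.arc e)

/-- `ℓ` is a lens of `G` at the pair `{u, v}`: `u ≠ v` are joined by at least one edge, no two
of the parallel edges joining them cross, and `ℓ` is a bounded connected component of the
complement of the union of the edges joining `u` and `v`. -/
def IsLensAt (u v : ℝ × ℝ) (ℓ : Set (ℝ × ℝ)) : Prop :=
  u ≠ v ∧ (∃ e, G.Joins e u v) ∧
  (∀ e f : G.ι, G.Joins e u v → G.Joins f u v → e ≠ f → ¬ G.Cross e f) ∧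
  Bornology.IsBounded ℓ ∧
  ∃ x ∈ (G.pairUnion u v)ᶜ, ℓ = connectedComponentIn (G.pairUnion u v)ᶜ x

/-- `ℓ` is a lens of `G`. -/
def IsLens (ℓ : Set (ℝ × ℝ)) : Prop := ∃ u v, G.IsLensAt u v ℓ

/-- `L(G)`: the set of all lenses of `G`. -/
def lenses : Set (Set (ℝ × ℝ)) := {ℓ | G.IsLens ℓ}

/-- No two parallel edges of `G` cross. -/
def ParallelNoncrossing : Prop := ∀ e f : G.ι, G.Parallel e f → ¬ G.Cross e f

/-- `G` is separated: no two parallel edges cross and every lens contains a vertex. -/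
def Separated : Prop :=
  G.ParallelNoncrossing ∧ ∀ ℓ, G.IsLens ℓ → ∃ v ∈ G.V, v ∈ ℓ

/-- The crossing number of `G`: the number of unordered pairs of distinct edges that cross. -/
noncomputable def crossingNumber : ℕ :=
  Nat.card {p : Sym2 G.ι // ¬ p.IsDiag ∧ ∀ e ∈ p, ∀ f ∈ p, e ≠ f → G.Cross e f}

/-- The degree of a vertex: the number of edges incident to it. -/
noncomputable def degree (v : ℝ × ℝ) : ℕ :=
  Nat.card {e : G.ι // v ∈ G.endpoints e}

end TopMultigraph

namespace TopMultigraph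

/-- The topological multigraph obtained from `G` by keeping only the vertices in `W ⊆ V(G)`
and those edges outside the deleted set `D` whose endpoints both lie in `W`. -/
noncomputable def restrict (G : TopMultigraph) (W : Finset (ℝ × ℝ)) (hW : W ⊆ G.V)
    (D : Set G.ι) : TopMultigraph where
  V := W
  ι := {e : G.ι // e ∉ D ∧ G.endpoints e ⊆ (W : Set (ℝ × ℝ))}
  fintype_ι := Fintype.ofFinite _
  arc := fun e => G.arc e.1
  continuous_arc := fun e => G.continuous_arc e.1
  injective_arc := fun e => G.injective_arc e.1
  source_mem := fun e => e.2.2 (by simp [endpoints])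
  target_mem := fun e => e.2.2 (by simp [endpoints])
  ends_ne := fun e => G.ends_ne e.1
  interior_avoids := fun e t h0 h1 hmem => G.interior_avoids e.1 t h0 h1 (hW hmem)

/-- The bisection width `b(G)` of a separated single-crossing topological multigraph `G`: the
minimum number of deleted edges admitting a vertex partition `V = V₁ ∪ V₂` with
`|V₁|, |V₂| ≤ 4n/5`, no remaining edge between `V₁` and `V₂`, and both remaining parts
separated single-crossing topological multigraphs. -/
noncomputable def bisectionWidth (G : TopMultigraph) : ℕ :=
  sInf {b : ℕ | ∃ (D : Set G.ι) (V₁ V₂ : Finset (ℝ × ℝ)) (h₁ : V₁ ⊆ G.V) (h₂ : V₂ ⊆ G.V),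
    D.ncard = b ∧ Disjoint V₁ V₂ ∧ V₁ ∪ V₂ = G.V ∧
    (V₁.card : ℝ) ≤ 4 * (G.V.card : ℝ) / 5 ∧ (V₂.card : ℝ) ≤ 4 * (G.V.card : ℝ) / 5 ∧
    (∀ e : G.ι, e ∉ D →
      G.endpoints e ⊆ (V₁ : Set (ℝ × ℝ)) ∨ G.endpoints e ⊆ (V₂ : Set (ℝ × ℝ))) ∧
    (G.restrict V₁ h₁ D).SingleCrossing ∧ (G.restrict V₁ h₁ D).Separated ∧
    (G.restrict V₂ h₂ D).SingleCrossing ∧ (G.restrict V₂ h₂ D).Separated}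

end TopMultigraph


/-! ### Continuous logarithms in the plane -/

/-- The identification of the plane with the complex numbers. -/
noncomputable def cx (p : ℝ × ℝ) : ℂ := Complex.equivRealProdCLM.symm p

lemma continuous_cx : Continuous cx := Complex.equivRealProdCLM.symm.continuous

lemma cx_inj {p q : ℝ × ℝ} (h : cx p = cx q) : p = q :=
  Complex.equivRealProdCLM.symm.injective h

lemma cx_surj (z : ℂ) : ∃ p, cx p = z := Complex.equivRealProdCLM.symm.surjective z

lemma bounded_cx {A : Set (ℝ × ℝ)} (hA : Bornology.IsBounded A) :
    ∃ M : ℝ, ∀ z ∈ A, ‖cx z‖ ≤ M := by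
  obtain ⟨M, hM⟩ := hA.exists_norm_le
  refine ⟨‖(Complex.equivRealProdCLM.symm : (ℝ × ℝ) →L[ℝ] ℂ)‖ * M, fun z hz => ?_⟩
  refine ((Complex.equivRealProdCLM.symm : (ℝ × ℝ) →L[ℝ] ℂ).le_opNorm z).trans ?_
  exact mul_le_mul_of_nonneg_left (hM z hz) (norm_nonneg _)

lemma bounded_of_cx {A : Set (ℝ × ℝ)} (M : ℝ) (hM : ∀ z ∈ A, ‖cx z‖ ≤ M) :
    Bornology.IsBounded A := by
  have h1 : Bornology.IsBounded (Metric.closedBall (0 : ℂ) M) := Metric.isBounded_closedBall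
  have h2 := (Complex.equivRealProdCLM : ℂ →L[ℝ] (ℝ × ℝ)).lipschitz.isBounded_image h1
  refine h2.subset fun z hz => ⟨cx z, by simpa using hM z hz, ?_⟩
  simp [cx]

lemma exists_lift_exp {X : Type*} [TopologicalSpace X] [SimplyConnectedSpace X]
    [LocallyPathConnectedSpace X] (f : X → ℂ) (hf : Continuous f) (h0 : ∀ x, f x ≠ 0) :
    ∃ L : X → ℂ, Continuous L ∧ ∀ x, Complex.exp (L x) = f x := by
  have x0 : X := Classical.arbitrary X
  obtain ⟨g, hg, -⟩ := Complex.isCoveringMapOn_exp.existsUnique_continuousMap_lifts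
    ⟨f, hf⟩ (a₀ := x0) (e₀ := Complex.log (f x0)) (by simp [Complex.exp_log (h0 x0)])
    (by simpa using fun x => h0 x)
  exact ⟨g, g.continuous, fun x => congrFun hg.2 x⟩

lemma exp_lift_unique {X : Type*} [TopologicalSpace X] {A : Set X} (hA : IsPreconnected A)
    {g h : X → ℂ} (hg : ContinuousOn g A) (hh : ContinuousOn h A)
    (he : ∀ z ∈ A, Complex.exp (g z) = Complex.exp (h z)) {x y : X} (hx : x ∈ A) (hy : y ∈ A) :
    g x - h x = g y - h y := by
  have key : ∀ z ∈ A, ∃ n : ℤ, g z = h z + n * (2 * Real.pi * Complex.I) := fun z hz =>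
    Complex.exp_eq_exp_iff_exists_int.1 (he z hz)
  have hd : IsDiscrete (range ((↑) : ℤ → ℝ)) := by
    rw [isDiscrete_iff_discreteTopology]
    exact Int.isClosedEmbedding_coe_real.isEmbedding.toHomeomorph.symm.isEmbedding.discreteTopology
  have hpi : (2 * Real.pi * Complex.I : ℂ) ≠ 0 := Complex.two_pi_I_ne_zero
  have h1 : ((g x - h x) / (2 * Real.pi * Complex.I)).re =
      ((g y - h y) / (2 * Real.pi * Complex.I)).re := by
    refine hA.constant_of_mapsTo (T := range ((↑) : ℤ → ℝ))
      (f := fun z => ((g z - h z) / (2 * Real.pi * Complex.I)).re) hd ?_ ?_ hx hy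
    · exact Complex.continuous_re.comp_continuousOn ((hg.sub hh).div_const _)
    · intro z hz
      obtain ⟨n, hn⟩ := key z hz
      refine ⟨n, ?_⟩
      simp only
      rw [hn, add_sub_cancel_left, mul_div_assoc, div_self hpi]; simp
  obtain ⟨n, hn⟩ := key x hx
  obtain ⟨m, hm⟩ := key y hy
  rw [hn, hm, add_sub_cancel_left, add_sub_cancel_left, mul_div_assoc, div_self hpi,
    mul_div_assoc, div_self hpi] at h1
  simp at h1
  rw [hn, hm, h1]; ring

/-- `cx z - cx x` has a continuous logarithm on `A`. -/
def HasLog (A : Set (ℝ × ℝ)) (x : ℝ × ℝ) : Prop :=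
  ∃ L : ℝ × ℝ → ℂ, ContinuousOn L A ∧ ∀ z ∈ A, Complex.exp (L z) = cx z - cx x

lemma HasLog.mono {A B : Set (ℝ × ℝ)} {x : ℝ × ℝ} (h : HasLog B x) (hAB : A ⊆ B) :
    HasLog A x := by
  obtain ⟨L, h1, h2⟩ := h
  exact ⟨L, h1.mono hAB, fun z hz => h2 z (hAB hz)⟩

lemma not_hasLog_frontier {O : Set (ℝ × ℝ)} (hO : IsOpen O) (hb : Bornology.IsBounded O)
    {x : ℝ × ℝ} (hx : x ∈ O) : ¬ HasLog (frontier O) x := by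
  rintro ⟨L, hL, hexp⟩
  obtain ⟨g, hg⟩ := ContinuousMap.exists_restrict_eq (s := frontier O) isClosed_frontier
    (⟨(frontier O).domRestrict L, hL.domRestrict⟩ : C(frontier O, ℂ))
  have hgL : ∀ z ∈ frontier O, g z = L z := fun z hz => by
    exact congrArg (fun k => k ⟨z, hz⟩) hg
  classical
  let F : ℝ × ℝ → ℂ := (closure O).piecewise (fun z => Complex.exp (g z)) (fun z => cx z - cx x)
  have hF : Continuous F := by
    refine Continuous.piecewise ?_ (Complex.continuous_exp.comp g.continuous)
      (continuous_cx.sub continuous_const)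
    intro z hz
    have hz' := frontier_closure_subset hz
    rw [hgL z hz', hexp z hz']
  have hF0 : ∀ z, F z ≠ 0 := by
    intro z
    by_cases hz : z ∈ closure O
    · simp [F, hz]
    · simp only [F, hz, not_false_eq_true, piecewise_eq_of_notMem]
      intro h
      exact hz (subset_closure (cx_inj (sub_eq_zero.1 h) ▸ hx))
  obtain ⟨G, hG, hGF⟩ := exists_lift_exp F hF hF0
  obtain ⟨M, hM⟩ := bounded_cx hb.closure
  have hM0 : 0 ≤ M := (norm_nonneg _).trans (hM x (subset_closure hx))
  let R : ℝ := M + ‖cx x‖ + 1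
  have hR : 0 < R := by positivity
  let z : ℝ → ℝ × ℝ := fun θ =>
    Complex.equivRealProdCLM (cx x + R * Complex.exp (θ * Complex.I))
  have hzc : Continuous z := by
    refine Complex.equivRealProdCLM.continuous.comp ?_
    fun_prop
  have hcz : ∀ θ, cx (z θ) = cx x + R * Complex.exp (θ * Complex.I) := fun θ =>
    Complex.equivRealProdCLM.symm_apply_apply _
  have hzn : ∀ θ, z θ ∉ closure O := by
    intro θ h
    have h1 := hM _ h
    rw [hcz] at h1
    have h2 : ‖(R * Complex.exp (θ * Complex.I) : ℂ)‖ = R := by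
      rw [norm_mul, Complex.norm_exp_ofReal_mul_I, mul_one, Complex.norm_real,
        Real.norm_of_nonneg hR.le]
    have h3 := norm_sub_norm_le (R * Complex.exp (θ * Complex.I) : ℂ) (-(cx x))
    rw [h2, norm_neg, sub_neg_eq_add, add_comm (R * _ : ℂ)] at h3
    have : R = M + ‖cx x‖ + 1 := rfl
    linarith
  have hlift : ∀ θ : ℝ, Complex.exp (G (z θ)) = R * Complex.exp (θ * Complex.I) := by
    intro θ
    rw [hGF, show F (z θ) = cx (z θ) - cx x from piecewise_eq_of_notMem _ _ _ (hzn θ), hcz]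
    ring
  have := exp_lift_unique (isPreconnected_univ (α := ℝ)) (g := fun θ => G (z θ))
    (h := fun θ : ℝ => (Real.log R : ℂ) + θ * Complex.I) (hG.comp hzc).continuousOn
    (by fun_prop) (fun θ _ => by
      rw [hlift, Complex.exp_add, ← Complex.ofReal_exp, Real.exp_log hR])
    (mem_univ 0) (mem_univ (2 * Real.pi))
  have hz2 : z (2 * Real.pi) = z 0 := by simp [z]
  rw [hz2] at this
  have h3 : ((2 * Real.pi : ℝ) : ℂ) * Complex.I = 0 := by
    have h4 := sub_right_injective this
    simpa using h4.symm
  simp [Real.pi_ne_zero] at h3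

lemma HasLog.of_near {A : Set (ℝ × ℝ)} {x y : ℝ × ℝ} (h : HasLog A x)
    (hxy : ∀ z ∈ A, ‖cx y - cx x‖ < ‖cx z - cx x‖) : HasLog A y := by
  obtain ⟨L, hL, he⟩ := h
  have hne : ∀ z ∈ A, cx z - cx x ≠ 0 := fun z hz h0 => by
    have := hxy z hz
    rw [h0, norm_zero] at this
    exact absurd this (not_lt.2 (norm_nonneg _))
  have hsl : ∀ z ∈ A, 1 + (-((cx y - cx x) / (cx z - cx x))) ∈ Complex.slitPlane := by
    intro z hz
    apply Complex.mem_slitPlane_of_norm_lt_one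
    rw [norm_neg, norm_div, div_lt_one (norm_pos_iff.2 (hne z hz))]
    exact hxy z hz
  refine ⟨fun z => L z + Complex.log (1 + (-((cx y - cx x) / (cx z - cx x)))), ?_, ?_⟩
  · refine hL.add (ContinuousOn.clog ?_ hsl)
    refine continuousOn_const.add (ContinuousOn.neg (continuousOn_const.div ?_ hne))
    exact (continuous_cx.sub continuous_const).continuousOn
  · intro z hz
    rw [Complex.exp_add, he z hz, Complex.exp_log (Complex.slitPlane_ne_zero (hsl z hz))]
    have := hne z hz
    field_simp
    ring

lemma hasLog_far {A : Set (ℝ × ℝ)} (hA : Bornology.IsBounded A) :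
    ∃ M : ℝ, ∀ x, M < ‖cx x‖ → HasLog A x := by
  obtain ⟨M, hM⟩ := bounded_cx hA
  refine ⟨max M 0, fun x hx => ?_⟩
  have hx0 : cx x ≠ 0 := norm_pos_iff.1 ((le_max_right _ _).trans_lt hx)
  have hsl : ∀ z ∈ A, 1 + (-(cx z / cx x)) ∈ Complex.slitPlane := by
    intro z hz
    apply Complex.mem_slitPlane_of_norm_lt_one
    rw [norm_neg, norm_div, div_lt_one (norm_pos_iff.2 hx0)]
    exact ((hM z hz).trans (le_max_left _ _)).trans_lt hx
  refine ⟨fun z => Complex.log (-cx x) + Complex.log (1 + (-(cx z / cx x))), ?_, ?_⟩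
  · refine continuousOn_const.add (ContinuousOn.clog ?_ hsl)
    exact continuousOn_const.add (continuous_cx.continuousOn.div_const _).neg
  · intro z hz
    rw [Complex.exp_add, Complex.exp_log (neg_ne_zero.2 hx0),
      Complex.exp_log (Complex.slitPlane_ne_zero (hsl z hz))]
    field_simp
    ring

lemma hasLog_locally_const {A : Set (ℝ × ℝ)} (hA : IsClosed A) {x : ℝ × ℝ} (hx : x ∉ A) :
    ∃ N : Set (ℝ × ℝ), IsOpen N ∧ x ∈ N ∧ ∀ y ∈ N, (HasLog A x ↔ HasLog A y) := by
  have hc : IsClosed (cx '' A) := by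
    have := (Complex.equivRealProdCLM.symm.toHomeomorph.isClosed_image (s := A)).2 hA
    exact this
  have hx' : cx x ∉ cx '' A := by
    rintro ⟨z, hz, h⟩
    exact hx (cx_inj h ▸ hz)
  obtain ⟨ε, hε, hball⟩ := Metric.isOpen_iff.1 hc.isOpen_compl (cx x) hx'
  have hfar : ∀ z ∈ A, ε ≤ ‖cx z - cx x‖ := by
    intro z hz
    by_contra h
    push Not at h
    exact hball (by simpa [dist_eq_norm] using h) ⟨z, hz, rfl⟩
  refine ⟨cx ⁻¹' Metric.ball (cx x) (ε / 2), Metric.isOpen_ball.preimage continuous_cx,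
    by simp [hε], fun y hy => ?_⟩
  have hy' : ‖cx y - cx x‖ < ε / 2 := by simpa [dist_eq_norm] using hy
  constructor
  · intro h
    exact h.of_near fun z hz => by linarith [hfar z hz]
  · intro h
    refine h.of_near fun z hz => ?_
    have h1 := hfar z hz
    have h2 : ‖cx z - cx x‖ ≤ ‖cx z - cx y‖ + ‖cx y - cx x‖ := by
      simpa using norm_add_le (cx z - cx y) (cx y - cx x)
    rw [norm_sub_rev]
    linarith

lemma isOpen_hasLog {A : Set (ℝ × ℝ)} (hA : IsClosed A) : IsOpen {y | y ∉ A ∧ HasLog A y} := by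
  rw [isOpen_iff_forall_mem_open]
  rintro x ⟨hx, h⟩
  obtain ⟨N, hN, hxN, hc⟩ := hasLog_locally_const hA hx
  exact ⟨N ∩ Aᶜ, fun y hy => ⟨hy.2, (hc y hy.1).1 h⟩, hN.inter hA.isOpen_compl, hxN, hx⟩

lemma isOpen_not_hasLog {A : Set (ℝ × ℝ)} (hA : IsClosed A) :
    IsOpen {y | y ∉ A ∧ ¬ HasLog A y} := by
  rw [isOpen_iff_forall_mem_open]
  rintro x ⟨hx, h⟩
  obtain ⟨N, hN, hxN, hc⟩ := hasLog_locally_const hA hx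
  exact ⟨N ∩ Aᶜ, fun y hy => ⟨hy.2, fun h' => h ((hc y hy.1).2 h')⟩,
    hN.inter hA.isOpen_compl, hxN, hx⟩

lemma HasLog.of_preconnected {A T : Set (ℝ × ℝ)} (hA : IsClosed A) (hT : IsPreconnected T)
    (hd : Disjoint T A) {x y : ℝ × ℝ} (hx : x ∈ T) (hy : y ∈ T) (h : HasLog A x) :
    HasLog A y := by
  have hsub := hT.subset_left_of_subset_union (isOpen_hasLog hA) (isOpen_not_hasLog hA)
    (by rw [Set.disjoint_left]; rintro z ⟨_, h1⟩ ⟨_, h2⟩; exact h2 h1)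
    (fun z hz => by
      have hzA : z ∉ A := Set.disjoint_left.1 hd hz
      by_cases hl : HasLog A z
      · exact Or.inl ⟨hzA, hl⟩
      · exact Or.inr ⟨hzA, hl⟩)
    ⟨x, hx, Set.disjoint_left.1 hd hx, h⟩
  exact (hsub hy).2

lemma hasLog_arc {α : unitInterval → ℝ × ℝ} (hc : Continuous α) (hi : Function.Injective α)
    {x : ℝ × ℝ} (hx : x ∉ range α) : HasLog (range α) x := by
  have hemb : Topology.IsClosedEmbedding α := hc.isClosedEmbedding hi
  have hcont : Continuous fun t : ℝ => cx (α (projIcc 0 1 zero_le_one t)) - cx x :=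
    (continuous_cx.comp (hc.comp continuous_projIcc)).sub continuous_const
  obtain ⟨L, hL, he⟩ := exists_lift_exp
    (fun t : ℝ => cx (α (projIcc 0 1 zero_le_one t)) - cx x) hcont
    (fun t h => hx ⟨_, cx_inj (sub_eq_zero.1 h)⟩)
  obtain ⟨g, hg⟩ := ContinuousMap.exists_extension hemb
    (⟨fun t => L t, hL.comp continuous_subtype_val⟩ : C(unitInterval, ℂ))
  refine ⟨g, g.continuous.continuousOn, ?_⟩
  rintro _ ⟨t, rfl⟩
  have h1 : g (α t) = L t := congrArg (fun k => k t) hg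
  rw [h1, he, projIcc_val]

lemma log_glue {A B : Set (ℝ × ℝ)} (hA : IsClosed A) (hB : IsClosed B) {x : ℝ × ℝ}
    {L M : ℝ × ℝ → ℂ} (hL : ContinuousOn L A) (hM : ContinuousOn M B)
    (heL : ∀ z ∈ A, Complex.exp (L z) = cx z - cx x)
    (heM : ∀ z ∈ B, Complex.exp (M z) = cx z - cx x)
    (hag : ∀ z ∈ A ∩ B, L z = M z) :
    ∃ K : ℝ × ℝ → ℂ, ContinuousOn K (A ∪ B) ∧ (∀ z ∈ A ∪ B, Complex.exp (K z) = cx z - cx x) ∧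
      ∀ z ∈ A, K z = L z := by
  classical
  have h1 : ∀ z ∈ A, A.piecewise L M z = L z := fun z hz => by simp [hz]
  have h2 : ∀ z ∈ B, A.piecewise L M z = M z := fun z hz => by
    by_cases hzA : z ∈ A
    · simp [hzA, hag z ⟨hzA, hz⟩]
    · simp [hzA]
  refine ⟨A.piecewise L M, ?_, ?_, h1⟩
  · exact (hL.congr h1).union_of_isClosed (hM.congr h2) hA hB
  · rintro z (hz | hz)
    · rw [h1 z hz, heL z hz]
    · rw [h2 z hz, heM z hz]

lemma HasLog.glue_point {A B : Set (ℝ × ℝ)} (hA : IsClosed A) (hB : IsClosed B) {x u : ℝ × ℝ}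
    (h1 : HasLog A x) (h2 : HasLog B x) (huA : u ∈ A) (huB : u ∈ B) (hu : A ∩ B ⊆ {u}) :
    HasLog (A ∪ B) x := by
  obtain ⟨L, hL, heL⟩ := h1
  obtain ⟨M, hM, heM⟩ := h2
  have hc : Complex.exp (L u - M u) = 1 := by
    rw [Complex.exp_sub, heL u huA, heM u huB, div_self]
    rw [← heL u huA]; exact Complex.exp_ne_zero _
  obtain ⟨K, hK, he, -⟩ := log_glue hA hB (x := x) hL (M := fun z => M z + (L u - M u))
    (hM.add continuousOn_const) heL
    (fun z hz => by rw [Complex.exp_add, hc, mul_one, heM z hz])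
    (fun z hz => by rw [mem_singleton_iff.1 (hu hz)]; ring)
  exact ⟨K, hK, he⟩


/-! ### Arcs in the plane -/

lemma plane_rank : 1 < Module.rank ℝ (ℝ × ℝ) := by
  rw [← Module.finrank_eq_rank]
  norm_num [Module.finrank_prod]

lemma closure_outer_of_arc {e f : unitInterval → ℝ × ℝ} (hec : Continuous e)
    (hei : Function.Injective e) (hfc : Continuous f) (hfi : Function.Injective f)
    (h0 : e 0 ∈ range f) (h1 : e 1 ∈ range f)
    (hinr : ∀ t, t ≠ 0 → t ≠ 1 → e t ∉ range f)
    {x : ℝ × ℝ} (hxe : x ∉ range e) (hxf : x ∉ range f)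
    (hx : ¬ HasLog (range e ∪ range f) x) {τ : unitInterval} (hτ0 : τ ≠ 0) (hτ1 : τ ≠ 1) :
    e τ ∈ closure {y | y ∉ range e ∪ range f ∧ HasLog (range e ∪ range f) y} := by
  by_contra hcon
  set C := range e ∪ range f with hC
  set W := {y | y ∉ C ∧ HasLog C y} with hW
  have hCc : IsCompact C := (isCompact_range hec).union (isCompact_range hfc)
  obtain ⟨N, hNW, hN, hpN⟩ : ∃ N : Set (ℝ × ℝ), Disjoint N W ∧ (IsOpen N ∧
      Bornology.IsBounded N) ∧ e τ ∈ N := by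
    refine ⟨(closure W)ᶜ ∩ Metric.ball (e τ) 1, ?_, ⟨isClosed_closure.isOpen_compl.inter
      Metric.isOpen_ball, Metric.isBounded_ball.subset inter_subset_right⟩, hcon, by simp⟩
    rw [Set.disjoint_left]
    exact fun z hz hzW => hz.1 (subset_closure hzW)
  have hnb : e ⁻¹' N ∈ nhds τ := (hN.1.preimage hec).mem_nhds hpN
  have hlt0 : (0 : unitInterval) < τ := lt_of_le_of_ne bot_le (Ne.symm hτ0)
  have hlt1 : τ < (1 : unitInterval) := lt_of_le_of_ne le_top hτ1
  obtain ⟨s, hs, hsN⟩ := exists_Ioc_subset_of_mem_nhds hnb ⟨0, hlt0⟩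
  obtain ⟨t, ht, htN⟩ := exists_Ico_subset_of_mem_nhds hnb ⟨1, hlt1⟩
  have hst : ∀ r, s < r → r < t → e r ∈ N := by
    intro r h1 h2
    rcases le_total r τ with h | h
    · exact hsN ⟨h1, h⟩
    · exact htN ⟨h, h2⟩
  let A := (e '' Iic s ∪ range f) ∪ e '' Ici t
  have hc1 : IsClosed (e '' Iic s) := (isClosed_Iic.isCompact.image hec).isClosed
  have hc2 : IsClosed (e '' Ici t) := (isClosed_Ici.isCompact.image hec).isClosed
  have hcf : IsClosed (range f) := (isCompact_range hfc).isClosed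
  have hAc : IsClosed A := (hc1.union hcf).union hc2
  have hle := hasLog_arc hec hei hxe
  have hlf := hasLog_arc hfc hfi hxf
  have hst' : s < t := hs.trans ht
  have hs1 : ∀ r ≤ s, r ≠ 1 := fun r hr h => absurd (hr.trans_lt (hst'.trans_le le_top)) (by
    rw [h]; exact lt_irrefl _)
  have ht0 : ∀ r, t ≤ r → r ≠ 0 := fun r hr h => absurd ((bot_le.trans_lt hst').trans_le hr) (by
    rw [h]; exact lt_irrefl _)
  have hAlog : HasLog A x := by
    refine HasLog.glue_point (u := e 1) (hc1.union hcf) hc2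
      (HasLog.glue_point (u := e 0) hc1 hcf (hle.mono (image_subset_range _ _)) hlf
        ⟨0, mem_Iic.2 bot_le, rfl⟩ h0 ?_)
      (hle.mono (image_subset_range _ _)) (Or.inr h1) ⟨1, mem_Ici.2 le_top, rfl⟩ ?_
    · rintro _ ⟨⟨r, hr, rfl⟩, hrf⟩
      by_contra hne
      exact hinr r (fun h => hne (by rw [h]; rfl)) (hs1 r hr) hrf
    · rintro _ ⟨h | h, ⟨r, hr, rfl⟩⟩
      · obtain ⟨r', hr', hrr⟩ := h
        have := hei hrr
        subst this
        exact absurd (hr'.trans_lt hst') (not_lt.2 hr)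
      · by_contra hne
        exact hinr r (ht0 r hr) (fun h => hne (by rw [h]; rfl)) h
  have hAC : A ⊆ C := by
    rintro z ((⟨r, -, rfl⟩ | h) | ⟨r, -, rfl⟩)
    · exact Or.inl ⟨r, rfl⟩
    · exact Or.inr h
    · exact Or.inl ⟨r, rfl⟩
  have hCA : ∀ z ∈ C, z ∉ A → z ∈ N := by
    rintro z (⟨r, rfl⟩ | h) hz
    · refine hst r ?_ ?_
      · by_contra h; exact hz (Or.inl (Or.inl ⟨r, not_lt.1 h, rfl⟩))
      · by_contra h; exact hz (Or.inr ⟨r, not_lt.1 h, rfl⟩)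
    · exact absurd (Or.inl (Or.inr h)) hz
  let O := {y | y ∉ C ∧ ¬ HasLog C y} ∪ (N ∩ Aᶜ)
  have hO : IsOpen O := (isOpen_not_hasLog hCc.isClosed).union (hN.1.inter hAc.isOpen_compl)
  have hWo : IsOpen W := isOpen_hasLog hCc.isClosed
  have hOW : Disjoint O W := by
    rw [Set.disjoint_left]
    rintro z (h | h) hz
    · exact h.2 hz.2
    · exact Set.disjoint_left.1 hNW h.1 hz
  have hcov : ∀ z, z ∉ A → z ∈ O ∨ z ∈ W := by
    intro z hz
    by_cases hzC : z ∈ C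
    · exact Or.inl (Or.inr ⟨hCA z hzC hz, hz⟩)
    · by_cases hl : HasLog C z
      · exact Or.inr ⟨hzC, hl⟩
      · exact Or.inl (Or.inl ⟨hzC, hl⟩)
  have hfr : frontier O ⊆ A := by
    intro z hz
    by_contra hzA
    rcases hcov z hzA with h | h
    · rw [hO.frontier_eq] at hz; exact hz.2 h
    · have := (hOW.closure_left hWo)
      exact Set.disjoint_left.1 this (frontier_subset_closure hz) h
  have hOb : Bornology.IsBounded O := by
    obtain ⟨M, hM⟩ := hasLog_far hCc.isBounded
    refine Bornology.IsBounded.union (bounded_of_cx M fun z hz => ?_)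
      (hN.2.subset inter_subset_left)
    by_contra h
    exact hz.2 (hM z (not_le.1 h))
  have hxO : x ∈ O := Or.inl ⟨by rintro (h | h); exacts [hxe h, hxf h], hx⟩
  exact not_hasLog_frontier hO hOb hxO (hAlog.mono hfr)

lemma arc_interior_empty {e : unitInterval → ℝ × ℝ} (hec : Continuous e)
    (hei : Function.Injective e) : interior (range e) = ∅ := by
  by_contra hne
  obtain ⟨p, hp⟩ := nonempty_iff_ne_empty.2 hne
  obtain ⟨ε, hε, hball⟩ := Metric.isOpen_iff.1 isOpen_interior p hp
  set B := Metric.ball p ε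
  have hBr : B ⊆ range e := hball.trans interior_subset
  have hemb := hec.isClosedEmbedding hei
  have hpre : ∀ S : Set (ℝ × ℝ), S ⊆ range e → IsPreconnected S → IsPreconnected (e ⁻¹' S) := by
    intro S hS hSp
    rw [← hemb.isInducing.isPreconnected_image, image_preimage_eq_of_subset hS]
    exact hSp
  have hBo : IsOpen (e ⁻¹' B) := Metric.isOpen_ball.preimage hec
  obtain ⟨t, ht⟩ := hBr (Metric.mem_ball_self hε)
  have htB : t ∈ e ⁻¹' B := by
    change e t ∈ B
    rw [ht]; exact Metric.mem_ball_self hε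
  -- an interior parameter with points on both sides
  have hex : ∃ a ∈ e ⁻¹' B, ∃ b ∈ e ⁻¹' B, ∃ c ∈ e ⁻¹' B, a < b ∧ b < c := by
    have hinf : (e ⁻¹' B).Infinite := by
      intro hfin
      have : (B).Finite := by
        rw [← image_preimage_eq_of_subset hBr]; exact hfin.image e
      exact (infinite_of_mem_nhds p (Metric.ball_mem_nhds p hε)) this
    obtain ⟨T, hT, hTc⟩ := hinf.exists_subset_card_eq 3
    have hs := T.orderEmbOfFin hTc
    refine ⟨T.orderEmbOfFin hTc 0, hT (T.orderEmbOfFin_mem hTc 0),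
      T.orderEmbOfFin hTc 1, hT (T.orderEmbOfFin_mem hTc 1),
      T.orderEmbOfFin hTc 2, hT (T.orderEmbOfFin_mem hTc 2), ?_, ?_⟩
    · exact (T.orderEmbOfFin hTc).strictMono (by decide)
    · exact (T.orderEmbOfFin hTc).strictMono (by decide)
  obtain ⟨a, ha, b, hb, c, hc, hab, hbc⟩ := hex
  have hBconn : IsPreconnected (B \ {e b}) := by
    let u := OpenPartialHomeomorph.univBall p ε
    have hsrc : u.source = univ := OpenPartialHomeomorph.univBall_source p ε
    have htgt : u.target = B := OpenPartialHomeomorph.univBall_target p hε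
    have heb : e b ∈ u.target := by rw [htgt]; exact hb
    have hC : IsPreconnected (({u.symm (e b)} : Set (ℝ × ℝ))ᶜ) :=
      (isConnected_compl_singleton_of_one_lt_rank plane_rank _).isPreconnected
    have hI := hC.image u (OpenPartialHomeomorph.continuous_univBall p ε).continuousOn
    have : u '' ({u.symm (e b)} : Set (ℝ × ℝ))ᶜ = B \ {e b} := by
      ext z
      constructor
      · rintro ⟨w, hw, rfl⟩
        refine ⟨htgt ▸ u.map_source (by rw [hsrc]; trivial), fun h => hw ?_⟩
        rw [mem_singleton_iff] at h ⊢
        rw [← h, u.left_inv (by rw [hsrc]; trivial)]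
      · rintro ⟨hz, hzb⟩
        have hz' : z ∈ u.target := by rw [htgt]; exact hz
        refine ⟨u.symm z, fun h => hzb ?_, u.right_inv hz'⟩
        rw [mem_singleton_iff] at h ⊢
        rw [← u.right_inv hz', h, u.right_inv heb]
    rw [← this]; exact hI
  have h2 := hpre _ (sdiff_subset.trans hBr) hBconn
  have h3 := h2.ordConnected.out (x := a) ⟨ha, fun h => hab.ne (hei h)⟩ (y := c)
    ⟨hc, fun h => hbc.ne' (hei h)⟩ ⟨hab.le, hbc.le⟩
  exact h3.2 rfl


/-! ### Components of open sets and lenses -/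

lemma cc_closure {U : Set (ℝ × ℝ)} (hU : IsClosed U) {x z : ℝ × ℝ}
    (hz : z ∈ closure (connectedComponentIn Uᶜ x)) (hzU : z ∉ U) :
    z ∈ connectedComponentIn Uᶜ x := by
  have ho : IsOpen (connectedComponentIn Uᶜ z) := hU.isOpen_compl.connectedComponentIn
  obtain ⟨w, hw1, hw2⟩ := mem_closure_iff.1 hz _ ho (mem_connectedComponentIn hzU)
  rw [connectedComponentIn_eq hw2, ← connectedComponentIn_eq hw1]
  exact mem_connectedComponentIn hzU

lemma cc_frontier {U : Set (ℝ × ℝ)} (hU : IsClosed U) (x : ℝ × ℝ) :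
    frontier (connectedComponentIn Uᶜ x) ⊆ U := by
  intro z hz
  by_contra h
  have ho : IsOpen (connectedComponentIn Uᶜ x) := hU.isOpen_compl.connectedComponentIn
  rw [ho.frontier_eq] at hz
  exact hz.2 (cc_closure hU hz.1 h)

lemma cc_max {F T : Set (ℝ × ℝ)} {x y : ℝ × ℝ} (hT : IsPreconnected T) (hTF : T ⊆ F)
    (hy : y ∈ T) (hyx : y ∈ connectedComponentIn F x) : T ⊆ connectedComponentIn F x := by
  rw [connectedComponentIn_eq hyx]
  exact hT.subset_connectedComponentIn hy hTF

lemma no_finite_frontier {O C : Set (ℝ × ℝ)} (hO : IsOpen O) (hb : Bornology.IsBounded O)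
    (hne : O.Nonempty) (hC : C.Finite) : ¬ frontier O ⊆ C := by
  intro h
  obtain ⟨x, hx⟩ := hne
  refine not_hasLog_frontier hO hb hx ⟨fun z => Complex.log (cx z - cx x),
    (hC.subset h).continuousOn _, fun z hz => Complex.exp_log fun h0 => ?_⟩
  rw [cx_inj (sub_eq_zero.1 h0), hO.frontier_eq] at hz
  exact hz.2 hx

namespace TopMultigraph

variable (G : TopMultigraph)

/-- Union of the arcs of a set of edges. -/
def eU (Q : Set G.ι) : Set (ℝ × ℝ) := ⋃ e ∈ Q, range (G.arc e)

/-- Edges of `K` joining `u` and `v`. -/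
def cls (K : Set G.ι) (u v : ℝ × ℝ) : Set G.ι := {e | e ∈ K ∧ G.Joins e u v}

variable {G}

lemma mem_eU {Q : Set G.ι} {z : ℝ × ℝ} : z ∈ G.eU Q ↔ ∃ e ∈ Q, z ∈ range (G.arc e) := by
  simp [eU]

lemma eU_mono {Q Q' : Set G.ι} (h : Q ⊆ Q') : G.eU Q ⊆ G.eU Q' :=
  biUnion_subset_biUnion_left h

lemma isCompact_eU (Q : Set G.ι) : IsCompact (G.eU Q) :=
  Q.toFinite.isCompact_biUnion fun e _ => isCompact_range (G.continuous_arc e)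

lemma isClosed_eU (Q : Set G.ι) : IsClosed (G.eU Q) := (isCompact_eU Q).isClosed

lemma dense_compl_eU (Q : Set G.ι) : Dense (G.eU Q)ᶜ := by
  have : (G.eU Q)ᶜ = ⋂ e ∈ Q, (range (G.arc e))ᶜ := by simp [eU]
  rw [this]
  refine dense_biInter_of_isOpen (fun e _ => (isCompact_range
    (G.continuous_arc e)).isClosed.isOpen_compl) Q.toFinite.countable fun e _ => ?_
  exact interior_eq_empty_iff_dense_compl.1
    (arc_interior_empty (G.continuous_arc e) (G.injective_arc e))

lemma arc_cases (e : G.ι) {z : ℝ × ℝ} (hz : z ∈ range (G.arc e)) :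
    z ∈ G.endpoints e ∨ z ∈ G.arcInterior e := by
  obtain ⟨t, rfl⟩ := hz
  by_cases h0 : t = 0
  · left; subst h0; simp [endpoints]
  by_cases h1 : t = 1
  · left; subst h1; simp [endpoints]
  exact Or.inr ⟨t, ⟨h0, h1⟩, rfl⟩

lemma arcInterior_subset (e : G.ι) : G.arcInterior e ⊆ range (G.arc e) := image_subset_range _ _

lemma endpoints_subset_range (e : G.ι) : G.endpoints e ⊆ range (G.arc e) := by
  rintro z (rfl | rfl) <;> exact ⟨_, rfl⟩

lemma endpoints_subset_V (e : G.ι) : G.endpoints e ⊆ G.V := by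
  rintro z (rfl | rfl)
  exacts [G.source_mem e, G.target_mem e]

lemma arcInterior_not_V (e : G.ι) {z : ℝ × ℝ} (hz : z ∈ G.arcInterior e) : z ∉ G.V := by
  obtain ⟨t, ⟨h0, h1⟩, rfl⟩ := hz
  exact G.interior_avoids e t h0 h1

lemma range_inter_V (e : G.ι) {z : ℝ × ℝ} (hz : z ∈ range (G.arc e)) (hV : z ∈ G.V) :
    z ∈ G.endpoints e :=
  (arc_cases e hz).resolve_right fun h => arcInterior_not_V e h hV

lemma setOf_eq_Ioo : {t : unitInterval | t ≠ 0 ∧ t ≠ 1} = Ioo 0 1 := by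
  ext t
  simp only [mem_ofPred_eq, mem_Ioo]
  exact ⟨fun h => ⟨lt_of_le_of_ne bot_le (Ne.symm h.1), lt_of_le_of_ne le_top h.2⟩,
    fun h => ⟨h.1.ne', h.2.ne⟩⟩

lemma arcInterior_preconnected (e : G.ι) : IsPreconnected (G.arcInterior e) := by
  unfold arcInterior
  rw [setOf_eq_Ioo]
  exact isPreconnected_Ioo.image _ (G.continuous_arc e).continuousOn

lemma endpoints_closure_interior (e : G.ι) : G.endpoints e ⊆ closure (G.arcInterior e) := by
  have h1 : closure (Ioo (0 : unitInterval) 1) = Icc 0 1 := closure_Ioo zero_ne_one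
  have h2 : G.arc e '' closure (Ioo (0 : unitInterval) 1) ⊆ closure (G.arcInterior e) := by
    unfold arcInterior
    rw [setOf_eq_Ioo]
    exact image_closure_subset_closure_image (G.continuous_arc e)
  rw [h1] at h2
  rintro z (rfl | rfl)
  · exact h2 ⟨0, ⟨le_rfl, zero_le_one⟩, rfl⟩
  · exact h2 ⟨1, ⟨zero_le_one, le_rfl⟩, rfl⟩

/-- Two noncrossing arcs meet only in common endpoints. -/
lemma range_inter_of_not_cross {e f : G.ι} (h : ¬ G.Cross e f) {z : ℝ × ℝ}
    (he : z ∈ range (G.arc e)) (hf : z ∈ range (G.arc f)) :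
    z ∈ G.endpoints e ∧ z ∈ G.endpoints f := by
  rcases arc_cases e he with h1 | h1
  · exact ⟨h1, range_inter_V f hf (endpoints_subset_V e h1)⟩
  rcases arc_cases f hf with h2 | h2
  · exact ⟨range_inter_V e he (endpoints_subset_V f h2), h2⟩
  exact absurd ⟨z, h1, h2⟩ h

lemma joins_ne {e : G.ι} {u v : ℝ × ℝ} (h : G.Joins e u v) : u ≠ v := by
  rintro rfl
  have h0 : G.arc e 0 ∈ ({u, u} : Set (ℝ × ℝ)) := by
    unfold Joins at h; rw [← h]; simp [endpoints]
  have h1 : G.arc e 1 ∈ ({u, u} : Set (ℝ × ℝ)) := by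
    unfold Joins at h; rw [← h]; simp [endpoints]
  simp only [mem_insert_iff, mem_singleton_iff, or_self] at h0 h1
  exact G.ends_ne e (h0.trans h1.symm)

lemma lens_aux {Q Q' : Set G.ι} {u v u' v' z : ℝ × ℝ} (hQ : ∀ e ∈ Q, G.Joins e u v)
    (hQ' : ∀ e ∈ Q', G.Joins e u' v') (hne : ({u, v} : Set (ℝ × ℝ)) ≠ {u', v'})
    (hnc : ∀ e ∈ Q, ∀ f ∈ Q', ¬ G.Cross e f) (hz' : z ∉ G.eU Q')
    (hz : z ∉ G.eU Q)
    (h1 : u' ∉ connectedComponentIn (G.eU Q)ᶜ z) (h2 : v' ∉ connectedComponentIn (G.eU Q)ᶜ z) :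
    connectedComponentIn (G.eU Q)ᶜ z ⊆ connectedComponentIn (G.eU Q')ᶜ z := by
  refine isPreconnected_connectedComponentIn.subset_connectedComponentIn
    (mem_connectedComponentIn hz) fun y hy hyQ => ?_
  obtain ⟨f, hf, hyf⟩ := mem_eU.1 hyQ
  have hfe : G.endpoints f = {u', v'} := hQ' f hf
  have hnv : ∀ w ∈ G.endpoints f, w ∉ connectedComponentIn (G.eU Q)ᶜ z := by
    rw [hfe]; rintro w (rfl | rfl) <;> assumption
  rcases arc_cases f hyf with h | h
  · exact hnv y h hy
  have hsub : G.arcInterior f ⊆ connectedComponentIn (G.eU Q)ᶜ z := by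
    refine cc_max (arcInterior_preconnected f) (fun w hw hwQ => ?_) h hy
    obtain ⟨e, he, hwe⟩ := mem_eU.1 hwQ
    have := (range_inter_of_not_cross (hnc e he f hf) hwe (arcInterior_subset f hw)).2
    exact arcInterior_not_V f hw (endpoints_subset_V f this)
  have hends : ∀ w ∈ G.endpoints f, w ∈ ({u, v} : Set (ℝ × ℝ)) := by
    intro w hw
    have hcl := closure_mono hsub (endpoints_closure_interior f hw)
    by_cases hwQ : w ∈ G.eU Q
    · obtain ⟨e, he, hwe⟩ := mem_eU.1 hwQ
      have := range_inter_V e hwe (endpoints_subset_V f hw)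
      rwa [hQ e he] at this
    · exact absurd (cc_closure (isClosed_eU Q) hcl hwQ) (hnv w hw)
  have hu := hends u' (by rw [hfe]; simp)
  have hv := hends v' (by rw [hfe]; simp)
  have huv' := joins_ne (hQ' f hf)
  apply hne
  simp only [mem_insert_iff, mem_singleton_iff] at hu hv
  rcases hu with rfl | rfl <;> rcases hv with rfl | rfl
  · exact absurd rfl huv'
  · rfl
  · exact pair_comm _ _
  · exact absurd rfl huv'

lemma crossing_lens {Q Q' : Set G.ι} {u v u' v' z : ℝ × ℝ} (hQ : ∀ e ∈ Q, G.Joins e u v)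
    (hQ' : ∀ e ∈ Q', G.Joins e u' v') (hne : ({u, v} : Set (ℝ × ℝ)) ≠ {u', v'})
    (hz' : z ∉ G.eU Q') (hz : z ∉ G.eU Q)
    (hb : Bornology.IsBounded (connectedComponentIn (G.eU Q)ᶜ z))
    (h1 : u' ∉ connectedComponentIn (G.eU Q)ᶜ z) (h2 : v' ∉ connectedComponentIn (G.eU Q)ᶜ z)
    (h3 : u ∉ connectedComponentIn (G.eU Q')ᶜ z) (h4 : v ∉ connectedComponentIn (G.eU Q')ᶜ z) :
    ∃ e ∈ Q, ∃ f ∈ Q', G.Cross e f := by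
  by_contra hcon
  push Not at hcon
  have hs1 := lens_aux hQ hQ' hne hcon hz' hz h1 h2
  have hs2 := lens_aux hQ' hQ hne.symm (fun e he f hf h => hcon f hf e he (by
    unfold Cross at h ⊢; rwa [inter_comm])) hz hz' h3 h4
  have heq := hs1.antisymm hs2
  have hf1 := cc_frontier (isClosed_eU Q) z
  have hf2 := cc_frontier (isClosed_eU Q') z
  rw [← heq] at hf2
  refine no_finite_frontier (C := {u, v}) (isClosed_eU Q).isOpen_compl.connectedComponentIn hb
    ⟨z, mem_connectedComponentIn hz⟩ (by simp) fun w hw => ?_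
  obtain ⟨e, he, hwe⟩ := mem_eU.1 (hf1 hw)
  obtain ⟨f, hf, hwf⟩ := mem_eU.1 (hf2 hw)
  have := (range_inter_of_not_cross (hcon e he f hf) hwe hwf).1
  rwa [hQ e he] at this

lemma lens_del {Q : Set G.ι} {u v x : ℝ × ℝ} (hQ : ∀ e ∈ Q, G.Joins e u v)
    (hnc : ∀ e ∈ Q, ∀ f ∈ Q, e ≠ f → ¬ G.Cross e f) (hx : x ∉ G.eU Q)
    (hb : Bornology.IsBounded (connectedComponentIn (G.eU Q)ᶜ x)) :
    ∃ e ∈ Q, ∀ x', x' ∉ G.eU (Q \ {e}) →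
      ∃ y, y ∉ G.eU Q ∧ y ∉ connectedComponentIn (G.eU Q)ᶜ x ∧
        connectedComponentIn (G.eU Q)ᶜ y ⊆ connectedComponentIn (G.eU (Q \ {e}))ᶜ x' := by
  classical
  set U := G.eU Q with hU
  set l := connectedComponentIn Uᶜ x with hl
  have hUc : IsClosed U := isClosed_eU Q
  have hlo : IsOpen l := hUc.isOpen_compl.connectedComponentIn
  have hxl : x ∈ l := mem_connectedComponentIn hx
  have hlU : l ⊆ Uᶜ := connectedComponentIn_subset _ _
  have hlp : IsPreconnected l := isPreconnected_connectedComponentIn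
  set F : Set G.ι := {e | e ∈ Q ∧ (G.arcInterior e ∩ frontier l).Nonempty} with hF
  have hfrU : frontier l ⊆ U := cc_frontier hUc x
  have hpair : ∀ e ∈ Q, ∀ f ∈ Q, e ≠ f → ∀ z, z ∈ range (G.arc e) → z ∈ range (G.arc f) →
      z ∈ ({u, v} : Set (ℝ × ℝ)) := fun e he f hf hef z h1 h2 => by
    have := (range_inter_of_not_cross (hnc e he f hf hef) h1 h2).1
    rwa [hQ e he] at this
  have huvr : ∀ e ∈ Q, ({u, v} : Set (ℝ × ℝ)) ⊆ range (G.arc e) := fun e he => by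
    rw [← hQ e he]; exact endpoints_subset_range e
  have hfr : ∀ z ∈ frontier l, z ∈ G.eU F ∨ z ∈ ({u, v} : Set (ℝ × ℝ)) := by
    intro z hz
    obtain ⟨e, he, hze⟩ := mem_eU.1 (hfrU hz)
    rcases arc_cases e hze with h | h
    · right; rwa [hQ e he] at h
    · exact Or.inl (mem_eU.2 ⟨e, ⟨he, z, h, hz⟩, hze⟩)
  have hFne : F.Nonempty := by
    by_contra hFe
    rw [not_nonempty_iff_eq_empty] at hFe
    refine no_finite_frontier (C := {u, v}) hlo hb ⟨x, hxl⟩ (by simp) fun z hz => ?_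
    refine (hfr z hz).resolve_left fun h => ?_
    rw [hFe] at h
    simp [eU] at h
  obtain ⟨f, hf⟩ := hFne
  have hfrF : frontier l ⊆ G.eU F := fun z hz => (hfr z hz).elim id fun h =>
    mem_eU.2 ⟨f, hf, huvr f hf.1 h⟩
  have hcl : ∀ e, IsClosed (range (G.arc e)) := fun e =>
    (isCompact_range (G.continuous_arc e)).isClosed
  have hxr : ∀ e ∈ Q, x ∉ range (G.arc e) := fun e he h => hx (mem_eU.2 ⟨e, he, h⟩)
  obtain ⟨e, heF, helog⟩ : ∃ e ∈ F, ¬ HasLog (range (G.arc e) ∪ range (G.arc f)) x := by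
    by_contra hcon
    push Not at hcon
    obtain ⟨L0, hL0, heL0⟩ := hasLog_arc (G.continuous_arc f) (G.injective_arc f) (hxr f hf.1)
    have key : ∀ T : Finset G.ι, (↑T ⊆ F) → ∃ K : ℝ × ℝ → ℂ,
        ContinuousOn K (range (G.arc f) ∪ G.eU ↑T) ∧
        (∀ z ∈ range (G.arc f) ∪ G.eU ↑T, Complex.exp (K z) = cx z - cx x) ∧
        ∀ z ∈ range (G.arc f), K z = L0 z := by
      intro T
      induction T using Finset.induction_on with
      | empty =>
        intro _
        have : range (G.arc f) ∪ G.eU ↑(∅ : Finset G.ι) = range (G.arc f) := by simp [eU]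
        rw [this]
        exact ⟨L0, hL0, heL0, fun _ _ => rfl⟩
      | insert e T heT ih =>
        intro hT
        rw [Finset.coe_insert, insert_subset_iff] at hT
        obtain ⟨K, hK, hKe, hK0⟩ := ih hT.2
        obtain ⟨M, hM, hMe⟩ := hcon e hT.1
        have hu : u ∈ range (G.arc f) := huvr f hf.1 (by simp)
        have hML : ∀ z ∈ range (G.arc f), M z - L0 z = M u - L0 u := fun z hz =>
          exp_lift_unique (isPreconnected_range (G.continuous_arc f))
            (hM.mono subset_union_right) hL0
            (fun w hw => by rw [hMe w (Or.inr hw), heL0 w hw]) hz hu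
        have hexp1 : Complex.exp (L0 u - M u) = 1 := by
          rw [Complex.exp_sub, heL0 u hu, hMe u (Or.inr hu), div_self]
          rw [← heL0 u hu]; exact Complex.exp_ne_zero _
        obtain ⟨K', hK', hKe', hKK⟩ := log_glue ((hcl f).union (isClosed_eU (T : Set G.ι)))
          (hcl e) (x := x) hK (M := fun z => M z + (L0 u - M u))
          ((hM.mono subset_union_left).add continuousOn_const) hKe
          (fun z hz => by rw [Complex.exp_add, hexp1, mul_one, hMe z (Or.inl hz)])
          (by
            rintro z ⟨h1, h2⟩
            have hzf : z ∈ range (G.arc f) := by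
              rcases h1 with h1 | h1
              · exact h1
              · obtain ⟨e', he', hz'⟩ := mem_eU.1 h1
                refine huvr f hf.1 (hpair e hT.1.1 e' (hT.2 he').1 ?_ z h2 hz')
                rintro rfl
                exact heT he'
            have := hML z hzf
            rw [hK0 z hzf]
            linear_combination -this)
        have hset : range (G.arc f) ∪ G.eU ↑(insert e T) =
            range (G.arc f) ∪ G.eU ↑T ∪ range (G.arc e) := by
          ext z
          simp only [Finset.coe_insert, mem_union, mem_eU, mem_insert_iff]
          constructor
          · rintro (h | ⟨a, rfl | h, h'⟩)
            · exact Or.inl (Or.inl h)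
            · exact Or.inr h'
            · exact Or.inl (Or.inr ⟨a, h, h'⟩)
          · rintro ((h | ⟨a, h, h'⟩) | h)
            · exact Or.inl h
            · exact Or.inr ⟨a, Or.inr h, h'⟩
            · exact Or.inr ⟨e, Or.inl rfl, h⟩
        refine ⟨K', ?_, ?_, fun z hz => ?_⟩
        · rw [hset]; exact hK'
        · rw [hset]; exact hKe'
        · rw [hKK z (Or.inl hz), hK0 z hz]
    obtain ⟨K, hK, hKe, -⟩ := key F.toFinite.toFinset (by rw [Finite.coe_toFinset])
    rw [Finite.coe_toFinset] at hK hKe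
    exact not_hasLog_frontier hlo hb hxl ⟨K, hK.mono (hfrF.trans subset_union_right),
      fun z hz => hKe z (Or.inr (hfrF hz))⟩
  have hef : e ≠ f := by
    rintro rfl
    rw [union_self] at helog
    exact helog (hasLog_arc (G.continuous_arc e) (G.injective_arc e) (hxr e heF.1))
  refine ⟨e, heF.1, fun x' hx' => ?_⟩
  set U' := G.eU (Q \ {e}) with hU'
  set l' := connectedComponentIn U'ᶜ x' with hl'
  have hU'c : IsClosed U' := isClosed_eU _
  have hl'o : IsOpen l' := hU'c.isOpen_compl.connectedComponentIn
  have hUU : Uᶜ ⊆ U'ᶜ := compl_subset_compl.2 (eU_mono sdiff_subset)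
  by_contra hcon
  have hsub : ∀ y ∈ l', y ∉ U → y ∈ l := by
    intro y hy hyU
    by_contra hyl
    refine hcon ⟨y, hyU, hyl, cc_max isPreconnected_connectedComponentIn
      ((connectedComponentIn_subset _ _).trans hUU) (mem_connectedComponentIn hyU) hy⟩
  have hdense : Dense Uᶜ := dense_compl_eU Q
  obtain ⟨y0, hy0, hy0U⟩ := hdense.inter_open_nonempty l' hl'o ⟨x', mem_connectedComponentIn hx'⟩
  have hll : l ⊆ l' := cc_max hlp (hlU.trans hUU) (hsub y0 hy0 hy0U) hy0
  obtain ⟨p, hpe, hpl⟩ := heF.2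
  have hpU' : p ∉ U' := by
    intro h
    obtain ⟨g, hg, hpg⟩ := mem_eU.1 h
    have h1 := hpair e heF.1 g hg.1 (fun h => hg.2 h.symm) p (arcInterior_subset e hpe) hpg
    rw [← hQ e heF.1] at h1
    exact arcInterior_not_V e hpe (endpoints_subset_V e h1)
  have hpl' : p ∈ l' := cc_closure hU'c (closure_mono hll (frontier_subset_closure hpl)) hpU'
  obtain ⟨τ, ⟨h0, h1⟩, rfl⟩ := hpe
  have hin : ∀ w ∈ G.endpoints e, w ∈ range (G.arc f) := fun w hw => by
    rw [hQ e heF.1] at hw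
    exact huvr f hf.1 hw
  have hcl2 := closure_outer_of_arc (G.continuous_arc e) (G.injective_arc e)
    (G.continuous_arc f) (G.injective_arc f) (hin _ (by simp [endpoints]))
    (hin _ (by simp [endpoints])) (fun t ht0 ht1 ht => by
      have h2 := hpair e heF.1 f hf.1 hef _ ⟨t, rfl⟩ ht
      rw [← hQ e heF.1] at h2
      exact G.interior_avoids e t ht0 ht1 (endpoints_subset_V e h2))
    (hxr e heF.1) (hxr f hf.1) helog h0 h1
  have hCcl : IsClosed (range (G.arc e) ∪ range (G.arc f)) := (hcl e).union (hcl f)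
  obtain ⟨y1, hy1, hy1W⟩ := mem_closure_iff.1 hcl2 l' hl'o hpl'
  obtain ⟨y, ⟨hy, hyW⟩, hyU⟩ := hdense.inter_open_nonempty _
    (hl'o.inter (isOpen_hasLog hCcl)) ⟨y1, hy1, hy1W⟩
  have hyl := hsub y hy hyU
  refine helog (HasLog.of_preconnected hCcl hlp ?_ hyl hxl hyW.2)
  rw [Set.disjoint_left]
  rintro w hw (h | h)
  · exact hlU hw (mem_eU.2 ⟨e, heF.1, h⟩)
  · exact hlU hw (mem_eU.2 ⟨f, hf.1, h⟩)

end TopMultigraph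


namespace TopMultigraph

variable {G : TopMultigraph}

/-! ### Repairing lenses -/

variable (G) in
/-- Ordered pairs of distinct crossing edges. -/
def crossPairs : Set (G.ι × G.ι) := {p | p.1 ≠ p.2 ∧ G.Cross p.1 p.2}

lemma cross_symm {e f : G.ι} (h : G.Cross e f) : G.Cross f e := by
  unfold Cross at h ⊢; rwa [inter_comm]

lemma crossPairs_ncard : G.crossPairs.ncard ≤ 2 * G.crossingNumber := by
  classical
  set S := G.crossPairs.toFinite.toFinset with hS
  have hScard : G.crossPairs.ncard = S.card := ncard_eq_toFinset_card _ _
  set C : Set (Sym2 G.ι) := {p | ¬ p.IsDiag ∧ ∀ e ∈ p, ∀ f ∈ p, e ≠ f → G.Cross e f} with hC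
  have hcr : G.crossingNumber = C.ncard := rfl
  have himg : (S.image fun p => s(p.1, p.2)).card ≤ C.ncard := by
    rw [← ncard_coe_finset]
    refine ncard_le_ncard ?_ C.toFinite
    intro q hq
    simp only [Finset.coe_image, mem_image, Finset.mem_coe] at hq
    obtain ⟨p, hp, rfl⟩ := hq
    rw [hS, Finite.mem_toFinset] at hp
    refine ⟨by simpa using hp.1, ?_⟩
    intro e he f hf hef
    rw [Sym2.mem_iff] at he hf
    rcases he with rfl | rfl <;> rcases hf with rfl | rfl
    · exact absurd rfl hef
    · exact hp.2
    · exact cross_symm hp.2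
    · exact absurd rfl hef
  have := Finset.card_le_mul_card_image (f := fun p : G.ι × G.ι => s(p.1, p.2)) S 2 (by
    intro b _
    induction b using Sym2.ind with
    | _ a c =>
    refine (Finset.card_le_card (t := {(a, c), (c, a)}) ?_).trans Finset.card_le_two
    intro p hp
    have h := (Finset.mem_filter.1 hp).2
    simp only [Finset.mem_insert, Finset.mem_singleton]
    rcases Sym2.eq_iff.1 h with h | h
    · left; exact Prod.ext h.1 h.2
    · right; exact Prod.ext h.1 h.2)
  rw [hScard, hcr]
  exact this.trans (Nat.mul_le_mul_left 2 himg)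

variable (G) in
/-- Edges of `K` with endpoint set `P`. -/
def clsP (K : Set G.ι) (P : Set (ℝ × ℝ)) : Set G.ι := {e | e ∈ K ∧ G.endpoints e = P}

variable (G) in
/-- A bounded face of a parallel class without a vertex of `W`. -/
def Bad (K : Set G.ι) (W : Set (ℝ × ℝ)) (P : Set (ℝ × ℝ)) (x : ℝ × ℝ) : Prop :=
  (∃ u v, P = {u, v}) ∧ x ∉ G.eU (G.clsP K P) ∧
  Bornology.IsBounded (connectedComponentIn (G.eU (G.clsP K P))ᶜ x) ∧
  ∀ w ∈ W, w ∉ connectedComponentIn (G.eU (G.clsP K P))ᶜ x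

lemma pairUnion_restrict {W : Finset (ℝ × ℝ)} (hW : W ⊆ G.V) (D : Set G.ι) (u v : ℝ × ℝ) :
    (G.restrict W hW D).pairUnion u v =
      G.eU (G.clsP {e | e ∉ D ∧ G.endpoints e ⊆ (W : Set (ℝ × ℝ))} {u, v}) := by
  ext z
  rw [mem_eU]
  simp only [pairUnion, mem_iUnion]
  constructor
  · rintro ⟨e, he, hz⟩
    exact ⟨e.1, ⟨e.2, he⟩, hz⟩
  · rintro ⟨e, ⟨h1, h2⟩, hz⟩
    exact ⟨⟨e, h1⟩, h2, hz⟩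

lemma restrict_noncrossing (h : G.ParallelNoncrossing) {W : Finset (ℝ × ℝ)} (hW : W ⊆ G.V)
    (D : Set G.ι) : (G.restrict W hW D).ParallelNoncrossing := by
  intro e f hef hc
  exact h e.1 f.1 ⟨fun h' => hef.1 (Subtype.ext h'), hef.2⟩ hc

lemma restrict_singleCrossing (h : G.SingleCrossing) {W : Finset (ℝ × ℝ)} (hW : W ⊆ G.V)
    (D : Set G.ι) : (G.restrict W hW D).SingleCrossing := by
  intro e f hef
  exact h e.1 f.1 (fun h' => hef (Subtype.ext h'))

lemma side_lemma (hpn : G.ParallelNoncrossing) {W : Finset (ℝ × ℝ)} (hW : W ⊆ G.V)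
    (D₀ : Set G.ι) (z : ℝ × ℝ)
    (hz : ∀ P x, G.Bad {e | e ∉ D₀ ∧ G.endpoints e ⊆ (W : Set (ℝ × ℝ))} W P x →
      z ∈ connectedComponentIn
        (G.eU (G.clsP {e | e ∉ D₀ ∧ G.endpoints e ⊆ (W : Set (ℝ × ℝ))} P))ᶜ x) :
    ∃ D' : Set G.ι, (∀ e ∈ D', G.endpoints e ⊆ (W : Set (ℝ × ℝ))) ∧
      D'.ncard * (D'.ncard - 1) ≤ 2 * G.crossingNumber ∧
      ∀ D : Set G.ι, (∀ e, G.endpoints e ⊆ (W : Set (ℝ × ℝ)) → (e ∈ D ↔ e ∈ D₀ ∪ D')) →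
        (G.restrict W hW D).Separated := by
  classical
  set K : Set G.ι := {e | e ∉ D₀ ∧ G.endpoints e ⊆ (W : Set (ℝ × ℝ))} with hK
  have hnc : ∀ P, ∀ e ∈ G.clsP K P, ∀ f ∈ G.clsP K P, e ≠ f → ¬ G.Cross e f :=
    fun P e he f hf hef => hpn e f ⟨hef, he.2.trans hf.2.symm⟩
  have hpick : ∀ P, ∃ oe : G.ι → Prop, (∃ x, G.Bad K W P x) → ∃ e, oe = (fun f => f = e) ∧
      e ∈ G.clsP K P ∧ ∃ x, G.Bad K W P x ∧ ∀ x', x' ∉ G.eU (G.clsP K P \ {e}) →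
      ∃ y, y ∉ G.eU (G.clsP K P) ∧ y ∉ connectedComponentIn (G.eU (G.clsP K P))ᶜ x ∧
        connectedComponentIn (G.eU (G.clsP K P))ᶜ y ⊆
          connectedComponentIn (G.eU (G.clsP K P \ {e}))ᶜ x' := by
    intro P
    by_cases h : ∃ x, G.Bad K W P x
    · obtain ⟨x, hx⟩ := h
      obtain ⟨u, v, huv⟩ := hx.1
      obtain ⟨e, he, hd⟩ := lens_del (u := u) (v := v)
        (fun e (he : e ∈ G.clsP K P) => show G.endpoints e = {u, v} by rw [he.2, huv])
        (hnc P) hx.2.1 hx.2.2.1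
      exact ⟨fun f => f = e, fun _ => ⟨e, rfl, he, x, hx, hd⟩⟩
    · exact ⟨fun _ => False, fun h' => absurd h' h⟩
  choose pick hpick using hpick
  set D' : Set G.ι := {e | (∃ x, G.Bad K W (G.endpoints e) x) ∧ pick (G.endpoints e) e} with hD'
  have hD'K : ∀ e ∈ D', e ∈ K := by
    rintro e ⟨h1, h2⟩
    obtain ⟨e', h3, h4, -⟩ := hpick _ h1
    rw [h3] at h2
    rw [show e = e' from h2]
    exact h4.1
  have hinj : ∀ e ∈ D', ∀ f ∈ D', G.endpoints e = G.endpoints f → e = f := by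
    rintro e ⟨h1, h2⟩ f ⟨h3, h4⟩ hef
    obtain ⟨e', h5, -⟩ := hpick _ h1
    rw [← hef, h5] at h4
    rw [h5] at h2
    exact Eq.trans h2 (Eq.symm h4)
  refine ⟨D', fun e he => (hD'K e he).2, ?_, ?_⟩
  · have hcross : ∀ e ∈ D', ∀ f ∈ D', e ≠ f → ∃ q : G.ι × G.ι, q ∈ G.crossPairs ∧
        G.endpoints q.1 = G.endpoints e ∧ G.endpoints q.2 = G.endpoints f := by
      rintro e he f hf hef
      have hne : G.endpoints e ≠ G.endpoints f := fun h => hef (hinj e he f hf h)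
      obtain ⟨x, hx⟩ := he.1
      obtain ⟨y, hy⟩ := hf.1
      have hzx := hz _ _ hx
      have hzy := hz _ _ hy
      have ex := connectedComponentIn_eq hzx
      have ey := connectedComponentIn_eq hzy
      have heW := (hD'K e he).2
      have hfW := (hD'K f hf).2
      obtain ⟨e', he', f', hf', hc⟩ := crossing_lens (G := G) (z := z)
        (u := G.arc e 0) (v := G.arc e 1) (u' := G.arc f 0) (v' := G.arc f 1)
        (Q := G.clsP K (G.endpoints e)) (Q' := G.clsP K (G.endpoints f))
        (fun a ha => ha.2) (fun a ha => ha.2) hne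
        (connectedComponentIn_subset _ _ hzy) (connectedComponentIn_subset _ _ hzx)
        (ex ▸ hx.2.2.1)
        (ex ▸ hx.2.2.2 _ (hfW (by simp [endpoints]))) (ex ▸ hx.2.2.2 _ (hfW (by simp [endpoints])))
        (ey ▸ hy.2.2.2 _ (heW (by simp [endpoints]))) (ey ▸ hy.2.2.2 _ (heW (by simp [endpoints])))
      refine ⟨(e', f'), ⟨fun h => ?_, hc⟩, he'.2, hf'.2⟩
      have h' : e' = f' := h
      exact hne (by rw [← he'.2, ← hf'.2, h'])
    choose! q hq1 hq2 hq3 using hcross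
    set T := D'.toFinite.toFinset with hT
    have hTc : D'.ncard = T.card := ncard_eq_toFinset_card _ _
    have h1 : T.offDiag.card ≤ G.crossPairs.toFinite.toFinset.card := by
      refine Finset.card_le_card_of_injOn (fun p => q p.1 p.2) ?_ ?_
      · intro p hp
        simp only [Finset.mem_coe, Finset.mem_offDiag, hT, Finite.mem_toFinset] at hp ⊢
        exact hq1 _ hp.1 _ hp.2.1 hp.2.2
      · intro p hp p' hp' hpp
        simp only [Finset.mem_coe, Finset.mem_offDiag, hT, Finite.mem_toFinset] at hp hp'
        have hpp' : q p.1 p.2 = q p'.1 p'.2 := hpp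
        refine Prod.ext (hinj _ hp.1 _ hp'.1 ?_) (hinj _ hp.2.1 _ hp'.2.1 ?_)
        · rw [← hq2 _ hp.1 _ hp.2.1 hp.2.2, ← hq2 _ hp'.1 _ hp'.2.1 hp'.2.2, hpp']
        · rw [← hq3 _ hp.1 _ hp.2.1 hp.2.2, ← hq3 _ hp'.1 _ hp'.2.1 hp'.2.2, hpp']
    rw [Finset.offDiag_card] at h1
    rw [hTc, Nat.mul_sub, mul_one]
    refine h1.trans ?_
    rw [← ncard_eq_toFinset_card]
    exact crossPairs_ncard
  · intro D hD
    refine ⟨restrict_noncrossing hpn hW D, ?_⟩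
    rintro l ⟨u, v, huv, -, -, hb, x, hx, rfl⟩
    rw [pairUnion_restrict] at hb hx ⊢
    have hsetK : ({e | e ∉ D ∧ G.endpoints e ⊆ (W : Set (ℝ × ℝ))} : Set G.ι) = K \ D' := by
      ext e
      constructor
      · rintro ⟨h1, h2⟩
        exact ⟨⟨fun h => h1 ((hD e h2).2 (Or.inl h)), h2⟩, fun h => h1 ((hD e h2).2 (Or.inr h))⟩
      · rintro ⟨⟨h1, h2⟩, h3⟩
        exact ⟨fun h => ((hD e h2).1 h).elim h1 h3, h2⟩
    rw [hsetK] at hb hx ⊢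
    set P : Set (ℝ × ℝ) := {u, v} with hP
    change ∃ w ∈ W, _
    by_cases hbad : ∃ x, G.Bad K W P x
    · obtain ⟨e, he1, he2, x0, hx0, hdel⟩ := hpick P hbad
      have hset : G.clsP (K \ D') P = G.clsP K P \ {e} := by
        ext f
        constructor
        · rintro ⟨⟨h1, h2⟩, h3⟩
          refine ⟨⟨h1, h3⟩, fun h => h2 ⟨by rwa [h3], ?_⟩⟩
          rw [h3, he1]; exact h
        · rintro ⟨⟨h1, h2⟩, h3⟩
          refine ⟨⟨h1, fun h => h3 ?_⟩, h2⟩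
          have := h.2
          rw [h2, he1] at this
          exact this
      rw [hset] at hb hx ⊢
      obtain ⟨y, hy1, hy2, hy3⟩ := hdel x hx
      by_contra hcon
      push Not at hcon
      have hyb : G.Bad K W P y := ⟨⟨u, v, rfl⟩, hy1, hb.subset hy3,
        fun w hw hwy => hcon w hw (hy3 hwy)⟩
      have e1 := connectedComponentIn_eq (hz _ _ hyb)
      have e2 := connectedComponentIn_eq (hz _ _ hx0)
      apply hy2
      rw [e2, ← e1]
      exact mem_connectedComponentIn hy1
    · have hset : G.clsP (K \ D') P = G.clsP K P := by
        ext f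
        constructor
        · rintro ⟨⟨h1, h2⟩, h3⟩
          exact ⟨h1, h3⟩
        · rintro ⟨h1, h2⟩
          exact ⟨⟨h1, fun h => hbad (h2 ▸ h.1)⟩, h2⟩
      rw [hset] at hb hx ⊢
      by_contra hcon
      push Not at hcon
      exact hbad ⟨x, ⟨u, v, rfl⟩, hx, hb, fun w hw => hcon w hw⟩

end TopMultigraph


namespace TopMultigraph

variable {G : TopMultigraph}

lemma bad_has_vertex (hsep : G.Separated) {K : Set G.ι} {W P : Set (ℝ × ℝ)} {x : ℝ × ℝ}
    (hb : G.Bad K W P x) :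
    ∃ w ∈ G.V, w ∉ W ∧ w ∈ connectedComponentIn (G.eU (G.clsP K P))ᶜ x := by
  obtain ⟨⟨u, v, rfl⟩, hx, hbd, hW⟩ := hb
  obtain ⟨e, he, -⟩ := lens_del (u := u) (v := v)
    (fun e (he : e ∈ G.clsP K {u, v}) => he.2)
    (fun e he f hf hef => hsep.1 e f ⟨hef, he.2.trans hf.2.symm⟩) hx hbd
  obtain ⟨y, hy, hyU⟩ := (dense_compl_eU (G.clsP univ {u, v})).inter_open_nonempty _
    ((isClosed_eU (G.clsP K {u, v})).isOpen_compl.connectedComponentIn (x := x))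
    ⟨x, mem_connectedComponentIn hx⟩
  have hsub : connectedComponentIn (G.eU (G.clsP univ {u, v}))ᶜ y ⊆
      connectedComponentIn (G.eU (G.clsP K {u, v}))ᶜ x :=
    cc_max isPreconnected_connectedComponentIn
      ((connectedComponentIn_subset _ _).trans (compl_subset_compl.2
        (eU_mono fun a ha => ⟨mem_univ _, ha.2⟩))) (mem_connectedComponentIn hyU) hy
  have hpu : G.pairUnion u v = G.eU (G.clsP univ {u, v}) := by
    unfold pairUnion eU clsP Joins
    simp
  obtain ⟨w, hwV, hw⟩ := hsep.2 (connectedComponentIn (G.eU (G.clsP univ {u, v}))ᶜ y)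
    ⟨u, v, joins_ne he.2, ⟨e, he.2⟩,
      fun e f h1 h2 hef => hsep.1 e f ⟨hef, h1.trans h2.symm⟩, hbd.subset hsub, y, by
        rw [hpu]; exact hyU, by rw [hpu]⟩
  exact ⟨w, hwV, fun h => hW w h (hsub hw), hsub hw⟩

/-- Bad faces on the side `W` all contain a common point. -/
def SideOK (G : TopMultigraph) (D₀ : Set G.ι) (W : Finset (ℝ × ℝ)) : Prop :=
  ∃ z, ∀ P x, G.Bad {e | e ∉ D₀ ∧ G.endpoints e ⊆ (W : Set (ℝ × ℝ))} W P x →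
      z ∈ connectedComponentIn
        (G.eU (G.clsP {e | e ∉ D₀ ∧ G.endpoints e ⊆ (W : Set (ℝ × ℝ))} P))ᶜ x

lemma width_le (hsc : G.SingleCrossing) (hsep : G.Separated) (D₀ : Set G.ι)
    (V₁ V₂ : Finset (ℝ × ℝ)) (hd : Disjoint V₁ V₂) (hu : V₁ ∪ V₂ = G.V)
    (hc1 : (V₁.card : ℝ) ≤ 4 * (G.V.card : ℝ) / 5) (hc2 : (V₂.card : ℝ) ≤ 4 * (G.V.card : ℝ) / 5)
    (hE : ∀ e : G.ι, e ∉ D₀ →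
      G.endpoints e ⊆ (V₁ : Set (ℝ × ℝ)) ∨ G.endpoints e ⊆ (V₂ : Set (ℝ × ℝ)))
    (hz1 : G.SideOK D₀ V₁) (hz2 : G.SideOK D₀ V₂) :
    ∃ k₁ k₂ : ℕ, k₁ * (k₁ - 1) ≤ 2 * G.crossingNumber ∧ k₂ * (k₂ - 1) ≤ 2 * G.crossingNumber ∧
      G.bisectionWidth ≤ D₀.ncard + k₁ + k₂ := by
  have h₁ : V₁ ⊆ G.V := hu ▸ Finset.subset_union_left
  have h₂ : V₂ ⊆ G.V := hu ▸ Finset.subset_union_right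
  obtain ⟨z₁, hz1⟩ := hz1
  obtain ⟨z₂, hz2⟩ := hz2
  obtain ⟨D₁, hD₁, hk₁, hs₁⟩ := side_lemma hsep.1 h₁ D₀ z₁ hz1
  obtain ⟨D₂, hD₂, hk₂, hs₂⟩ := side_lemma hsep.1 h₂ D₀ z₂ hz2
  refine ⟨D₁.ncard, D₂.ncard, hk₁, hk₂, ?_⟩
  have hexcl : ∀ e, G.endpoints e ⊆ (V₁ : Set (ℝ × ℝ)) → G.endpoints e ⊆ (V₂ : Set (ℝ × ℝ)) →
      False := fun e he1 he2 => by
    have h0 : G.arc e 0 ∈ G.endpoints e := by simp [endpoints]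
    exact Finset.disjoint_left.1 hd (he1 h0) (he2 h0)
  have hle : G.bisectionWidth ≤ (D₀ ∪ D₁ ∪ D₂).ncard := by
    refine Nat.sInf_le ⟨D₀ ∪ D₁ ∪ D₂, V₁, V₂, h₁, h₂, rfl, hd, hu, hc1, hc2,
      fun e he => hE e fun h => he (Or.inl (Or.inl h)), restrict_singleCrossing hsc h₁ _,
      hs₁ _ ?_, restrict_singleCrossing hsc h₂ _, hs₂ _ ?_⟩
    · intro e he
      refine ⟨fun h => h.elim id fun h => (hexcl e he (hD₂ e h)).elim, fun h => Or.inl h⟩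
    · intro e he
      refine ⟨?_, ?_⟩
      · rintro ((h | h) | h)
        · exact Or.inl h
        · exact (hexcl e (hD₁ e h) he).elim
        · exact Or.inr h
      · rintro (h | h)
        · exact Or.inl (Or.inl h)
        · exact Or.inr h
  have h3 := ncard_union_le (D₀ ∪ D₁) D₂
  have h4 := ncard_union_le D₀ D₁
  omega

/-- Cutting along a set `Φ` such that `Φ` and its complement are connected. -/
lemma cut_face (hsc : G.SingleCrossing) (hsep : G.Separated) (D₀ : Set G.ι)
    (Φ : Set (ℝ × ℝ)) (h1 : IsPreconnected Φ) (h2 : IsPreconnected Φᶜ)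
    (hE : ∀ e : G.ι, e ∉ D₀ → range (G.arc e) ⊆ Φ ∨ range (G.arc e) ⊆ Φᶜ)
    (V₁ V₂ : Finset (ℝ × ℝ)) (hV₁ : ∀ v, v ∈ V₁ ↔ v ∈ G.V ∧ v ∉ Φ)
    (hV₂ : ∀ v, v ∈ V₂ ↔ v ∈ G.V ∧ v ∈ Φ) (n1 : V₁.Nonempty) (n2 : V₂.Nonempty)
    (hc1 : (V₁.card : ℝ) ≤ 4 * (G.V.card : ℝ) / 5)
    (hc2 : (V₂.card : ℝ) ≤ 4 * (G.V.card : ℝ) / 5) :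
    ∃ k₁ k₂ : ℕ, k₁ * (k₁ - 1) ≤ 2 * G.crossingNumber ∧ k₂ * (k₂ - 1) ≤ 2 * G.crossingNumber ∧
      G.bisectionWidth ≤ D₀.ncard + k₁ + k₂ := by
  refine width_le hsc hsep D₀ V₁ V₂ ?_ ?_ hc1 hc2 ?_ ?_ ?_
  · rw [Finset.disjoint_left]
    intro v h h'
    exact ((hV₁ v).1 h).2 ((hV₂ v).1 h').2
  · ext v
    rw [Finset.mem_union, hV₁, hV₂]
    tauto
  · intro e he
    have hV := endpoints_subset_V e
    have hr := endpoints_subset_range e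
    rcases hE e he with h | h
    · right; intro w hw; exact (hV₂ w).2 ⟨hV hw, h (hr hw)⟩
    · left; intro w hw; exact (hV₁ w).2 ⟨hV hw, h (hr hw)⟩
  · obtain ⟨z, hz⟩ := n2
    refine ⟨z, fun P x hb => ?_⟩
    obtain ⟨w, hwV, hwW, hw⟩ := bad_has_vertex hsep hb
    have hwΦ : w ∈ Φ := by
      by_contra h
      exact hwW ((hV₁ w).2 ⟨hwV, h⟩)
    refine cc_max h1 ?_ hwΦ hw ((hV₂ z).1 hz).2
    intro y hy hyU
    obtain ⟨e, he, hye⟩ := mem_eU.1 hyU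
    rcases hE e he.1.1 with h | h
    · have h0 : G.arc e 0 ∈ G.endpoints e := by simp [endpoints]
      exact ((hV₁ _).1 (he.1.2 h0)).2 (h ⟨0, rfl⟩)
    · exact h hye hy
  · obtain ⟨z, hz⟩ := n1
    refine ⟨z, fun P x hb => ?_⟩
    obtain ⟨w, hwV, hwW, hw⟩ := bad_has_vertex hsep hb
    have hwΦ : w ∈ Φᶜ := by
      intro h
      exact hwW ((hV₂ w).2 ⟨hwV, h⟩)
    refine cc_max h2 ?_ hwΦ hw ((hV₁ z).1 hz).2
    intro y hy hyU
    obtain ⟨e, he, hye⟩ := mem_eU.1 hyU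
    rcases hE e he.1.1 with h | h
    · exact hy (h hye)
    · have h0 : G.arc e 0 ∈ G.endpoints e := by simp [endpoints]
      exact h ⟨0, rfl⟩ ((hV₂ _).1 (he.1.2 h0)).2

end TopMultigraph


/-! ### Cuts along a family of continua -/

lemma face_compl_preconnected {R : Set (ℝ × ℝ)} (hR : IsClosed R) (hRp : IsPreconnected R)
    (hne : R.Nonempty) (x : ℝ × ℝ) : IsPreconnected (connectedComponentIn Rᶜ x)ᶜ := by
  obtain ⟨r, hr⟩ := hne
  have hRφ : ∀ y, R ⊆ (connectedComponentIn Rᶜ y)ᶜ := fun y z hz hz' =>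
    connectedComponentIn_subset _ _ hz' hz
  refine isPreconnected_of_forall r fun y hy => ?_
  by_cases hyR : y ∈ R
  · exact ⟨R, hRφ x, hr, hyR, hRp⟩
  set ψ := connectedComponentIn Rᶜ y with hψ
  have hyψ : y ∈ ψ := mem_connectedComponentIn hyR
  have hmeet : (closure ψ ∩ R).Nonempty := by
    by_contra hcon
    have hcl : IsClosed ψ := by
      refine isClosed_of_closure_subset fun z hz => cc_closure hR hz fun hzR => ?_
      exact hcon ⟨z, hz, hzR⟩
    have := IsClopen.eq_univ ⟨hcl, hR.isOpen_compl.connectedComponentIn⟩ ⟨y, hyψ⟩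
    have hr' : r ∈ ψ := by rw [this]; trivial
    exact connectedComponentIn_subset _ _ hr' hr
  obtain ⟨p, hp1, hp2⟩ := hmeet
  refine ⟨closure ψ ∪ R, ?_, Or.inr hr, Or.inl (subset_closure hyψ),
    IsPreconnected.union p hp1 hp2 isPreconnected_connectedComponentIn.closure hRp⟩
  rintro z (hz | hz)
  · by_cases hzR : z ∈ R
    · exact hRφ x hzR
    · have hzψ := cc_closure hR hz hzR
      intro hzx
      apply hy
      rw [connectedComponentIn_eq hzx, ← connectedComponentIn_eq hzψ]
      exact hyψ
  · exact hRφ x hz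

namespace TopMultigraph

variable {G : TopMultigraph}

lemma bad_class_nonempty (hsep : G.Separated) {K : Set G.ι} {W P : Set (ℝ × ℝ)} {x : ℝ × ℝ}
    (hb : G.Bad K W P x) : ∃ e, e ∈ G.clsP K P := by
  obtain ⟨⟨u, v, rfl⟩, hx, hbd, hW⟩ := hb
  obtain ⟨e, he, -⟩ := lens_del (u := u) (v := v)
    (fun e (he : e ∈ G.clsP K {u, v}) => he.2)
    (fun e he f hf hef => hsep.1 e f ⟨hef, he.2.trans hf.2.symm⟩) hx hbd
  exact ⟨e, he⟩

open Classical in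
lemma cut_or_central (hsc : G.SingleCrossing) (hsep : G.Separated) (hn : 1 ≤ G.V.card)
    (D₀ : Set G.ι)
    {κ : Type*} [Finite κ] (R : κ → Set (ℝ × ℝ)) (hRc : ∀ k, IsClosed (R k))
    (hRp : ∀ k, IsPreconnected (R k)) (hRn : ∀ k, (R k).Nonempty)
    (hRd : ∀ j k, j ≠ k → Disjoint (R j) (R k)) (hV : ∀ v ∈ G.V, ∃ k, v ∈ R k)
    (hE : ∀ e : G.ι, e ∉ D₀ → ∃ k, range (G.arc e) ⊆ R k) :
    (∃ k₁ k₂ : ℕ, k₁ * (k₁ - 1) ≤ 2 * G.crossingNumber ∧ k₂ * (k₂ - 1) ≤ 2 * G.crossingNumber ∧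
      G.bisectionWidth ≤ D₀.ncard + k₁ + k₂) ∨
    ∃ k, ∀ x, x ∉ R k →
      5 * (G.V.filter (fun v => v ∈ connectedComponentIn (R k)ᶜ x)).card < G.V.card := by
  by_contra hcon
  rw [not_or] at hcon
  obtain ⟨hA, hB⟩ := hcon
  push Not at hB
  choose x hx hbig using hB
  set φ : κ → Set (ℝ × ℝ) := fun k => connectedComponentIn (R k)ᶜ (x k) with hφ
  have hφp : ∀ k, IsPreconnected (φ k) := fun k => isPreconnected_connectedComponentIn
  have hφc : ∀ k, IsPreconnected (φ k)ᶜ := fun k =>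
    face_compl_preconnected (hRc k) (hRp k) (hRn k) (x k)
  have hφR : ∀ k, R k ⊆ (φ k)ᶜ := fun k z hz hz' => connectedComponentIn_subset _ _ hz' hz
  have hdich : ∀ (S : Set (ℝ × ℝ)) k, IsPreconnected S → Disjoint S (R k) →
      S ⊆ φ k ∨ S ⊆ (φ k)ᶜ := by
    intro S k hS hd
    by_cases h : (S ∩ φ k).Nonempty
    · obtain ⟨y, hy1, hy2⟩ := h
      exact Or.inl (cc_max hS (fun z hz hz' => Set.disjoint_left.1 hd hz hz') hy1 hy2)
    · right
      intro z hz hz'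
      exact h ⟨z, hz, hz'⟩
  have hφV : ∀ k, 4 * G.V.card < 5 * (G.V.filter (fun v => v ∈ φ k)).card := by
    intro k
    by_contra hle
    apply hA
    have hsplit := Finset.card_filter_add_card_filter_not (s := G.V) (fun v => v ∈ φ k)
    have hb := hbig k
    change G.V.card ≤ 5 * (G.V.filter (fun v => v ∈ φ k)).card at hb
    refine cut_face hsc hsep D₀ (φ k) (hφp k) (hφc k) ?_
      (G.V.filter fun v => v ∉ φ k) (G.V.filter fun v => v ∈ φ k) (by simp) (by simp) ?_ ?_ ?_ ?_
    · intro e he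
      obtain ⟨j, hj⟩ := hE e he
      by_cases hjk : j = k
      · right; subst hjk; exact hj.trans (hφR j)
      · rcases hdich (R j) k (hRp j) (hRd j k hjk) with h | h
        · exact Or.inl (hj.trans h)
        · exact Or.inr (hj.trans h)
    · rw [← Finset.card_pos]; omega
    · rw [← Finset.card_pos]; omega
    · rw [le_div_iff₀ (by norm_num)]
      have : (G.V.filter fun v => v ∉ φ k).card * 5 ≤ 4 * G.V.card := by omega
      exact_mod_cast this
    · rw [le_div_iff₀ (by norm_num)]
      have : (G.V.filter fun v => v ∈ φ k).card * 5 ≤ 4 * G.V.card := by omega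
      exact_mod_cast this
  -- the sets M
  set M : κ → Set (ℝ × ℝ) := fun k => (φ k)ᶜ with hM
  have hMV : ∀ k, 5 * (G.V.filter (fun v => v ∈ M k)).card < G.V.card := by
    intro k
    have hsplit := Finset.card_filter_add_card_filter_not (s := G.V) (fun v => v ∈ φ k)
    have h1 := hφV k
    have : (G.V.filter (fun v => v ∈ M k)) = (G.V.filter (fun v => v ∉ φ k)) := by
      simp [hM]
    rw [this]; omega
  have hmeet : ∀ j k, (φ j ∩ φ k).Nonempty := by
    intro j k
    by_contra hne
    have hd : Disjoint (G.V.filter (fun v => v ∈ φ j)) (G.V.filter (fun v => v ∈ φ k)) := by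
      rw [Finset.disjoint_left]
      intro v h1 h2
      exact hne ⟨v, (Finset.mem_filter.1 h1).2, (Finset.mem_filter.1 h2).2⟩
    have h1 := hφV j
    have h2 := hφV k
    have h3 := Finset.card_union_of_disjoint hd
    have h4 : ((G.V.filter (fun v => v ∈ φ j)) ∪ (G.V.filter (fun v => v ∈ φ k))).card ≤
        G.V.card := Finset.card_le_card (Finset.union_subset (Finset.filter_subset _ _)
          (Finset.filter_subset _ _))
    omega
  have hlam1 : ∀ j k, j ≠ k → R j ⊆ (φ k)ᶜ → M j ⊆ M k := by
    intro j k hjk h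
    obtain ⟨y, hy1, hy2⟩ := hmeet j k
    refine compl_subset_compl.2 (cc_max (hφp k) (fun z hz hz' => h hz' hz) hy2 hy1)
  have hlam : ∀ j k, M j ⊆ M k ∨ M k ⊆ M j ∨ Disjoint (M j) (M k) := by
    intro j k
    by_cases hjk : j = k
    · left; rw [hjk]
    rcases hdich (R j) k (hRp j) (hRd j k hjk) with h1 | h1
    · rcases hdich (R k) j (hRp k) (hRd k j (Ne.symm hjk)) with h2 | h2
      · right; right
        obtain ⟨r, hr⟩ := hRn k
        have : M k ⊆ φ j := cc_max (hφc k) (fun z hz hz' => hz (h1 hz')) (hφR k hr) (h2 hr)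
        rw [Set.disjoint_right]
        exact fun z hz hz' => hz' (this hz)
      · exact Or.inr (Or.inl (hlam1 k j (Ne.symm hjk) h2))
    · exact Or.inl (hlam1 j k hjk h1)
  set MM : Set (Set (ℝ × ℝ)) := {m | Maximal (fun s => s ∈ range M) m} with hMM
  have hMMsub : ∀ m ∈ MM, ∃ k, M k = m := fun m hm => hm.1
  have hfin : (range M).Finite := finite_range M
  have hMMfin : MM.Finite := hfin.subset fun m hm => hm.1
  have hcover : ∀ k, ∃ m ∈ MM, M k ⊆ m := by
    intro k
    obtain ⟨m, hm1, hm2⟩ := hfin.exists_le_maximal (mem_range_self k)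
    exact ⟨m, hm2, hm1⟩
  have hdisj : ∀ m ∈ MM, ∀ m' ∈ MM, (m ∩ m').Nonempty → m = m' := by
    intro m hm m' hm' ⟨y, hy, hy'⟩
    obtain ⟨j, hj⟩ := hMMsub m hm
    obtain ⟨k, hk⟩ := hMMsub m' hm'
    rcases hlam j k with h | h | h
    · rw [hj, hk] at h
      exact hm.eq_of_subset hm'.1 h
    · rw [hj, hk] at h
      exact (hm'.eq_of_subset hm.1 h).symm
    · rw [hj, hk] at h
      exact absurd hy' (Set.disjoint_left.1 h hy)
  have hEM : ∀ e, e ∉ D₀ → ∃ m ∈ MM, range (G.arc e) ⊆ m := by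
    intro e he
    obtain ⟨k, hk⟩ := hE e he
    obtain ⟨m, hm, hkm⟩ := hcover k
    exact ⟨m, hm, (hk.trans (hφR k)).trans hkm⟩
  have hVM : ∀ v ∈ G.V, ∃ m ∈ MM, v ∈ m := by
    intro v hv
    obtain ⟨k, hk⟩ := hV v hv
    obtain ⟨m, hm, hkm⟩ := hcover k
    exact ⟨m, hm, hkm (hφR k hk)⟩
  have hside : ∀ W : Finset (ℝ × ℝ), W ⊆ G.V → G.V.card ≤ 5 * W.card →
      (∀ m ∈ MM, ∀ v ∈ W, v ∈ m → ∀ w ∈ G.V, w ∈ m → w ∈ W) → G.SideOK D₀ W := by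
    intro W hW hWc hWm
    refine ⟨0, fun P y hb => ?_⟩
    exfalso
    obtain ⟨e, he⟩ := bad_class_nonempty hsep hb
    obtain ⟨w, hwV, hwW, hw⟩ := bad_has_vertex hsep hb
    obtain ⟨m, hm, hem⟩ := hEM e he.1.1
    have h0 : G.arc e 0 ∈ G.endpoints e := by simp [endpoints]
    have hmW := hWm m hm (G.arc e 0) (he.1.2 h0) (hem ⟨0, rfl⟩)
    have hwm : w ∈ mᶜ := fun h => hwW (hmW w hwV h)
    obtain ⟨k, hk⟩ := hMMsub m hm
    have hmc : mᶜ = φ k := by rw [← hk, hM]; simp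
    have hsub : mᶜ ⊆ connectedComponentIn (G.eU (G.clsP {e | e ∉ D₀ ∧ G.endpoints e ⊆
        (W : Set (ℝ × ℝ))} P))ᶜ y := by
      refine cc_max (hmc ▸ hφp k) (fun p hp hpU => ?_) hwm hw
      obtain ⟨f, hf, hpf⟩ := mem_eU.1 hpU
      obtain ⟨m', hm', hfm⟩ := hEM f hf.1.1
      have h0' : G.arc e 0 ∈ G.endpoints f := by rw [hf.2, ← he.2]; exact h0
      have := hdisj m hm m' hm' ⟨_, hem ⟨0, rfl⟩, hfm (endpoints_subset_range f h0')⟩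
      exact hp (this ▸ hfm hpf)
    have hall : ∀ v ∈ W, v ∈ m := by
      intro v hv
      by_contra hvm
      exact hb.2.2.2 v hv (hsub hvm)
    have hWle : W.card ≤ (G.V.filter (fun v => v ∈ M k)).card := by
      refine Finset.card_le_card fun v hv => Finset.mem_filter.2 ⟨hW hv, ?_⟩
      rw [hk]; exact hall v hv
    have := hMV k
    omega
  -- grouping
  set N : Finset (Set (ℝ × ℝ)) → Finset (ℝ × ℝ) :=
    fun T => G.V.filter (fun v => ∃ m ∈ T, v ∈ m) with hN
  have hgreedy : ∀ T : Finset (Set (ℝ × ℝ)), ↑T ⊆ MM → 5 * (N T).card < G.V.card ∨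
      ∃ T' : Finset (Set (ℝ × ℝ)), ↑T' ⊆ MM ∧ G.V.card ≤ 5 * (N T').card ∧
        5 * (N T').card ≤ 4 * G.V.card := by
    intro T
    induction T using Finset.induction_on with
    | empty =>
      intro _; left
      have h0 : N ∅ = ∅ := by simp [hN]
      rw [h0, Finset.card_empty]; omega
    | insert m T hmT ih =>
      intro hT
      rw [Finset.coe_insert, insert_subset_iff] at hT
      rcases ih hT.2 with h | h
      · by_cases hlt : 5 * (N (insert m T)).card < G.V.card
        · exact Or.inl hlt
        · right
          refine ⟨insert m T, by rw [Finset.coe_insert, insert_subset_iff]; exact hT,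
            by omega, ?_⟩
          obtain ⟨k, hk⟩ := hMMsub m hT.1
          have h1 := hMV k
          have h2 : (N (insert m T)).card ≤ (N T).card +
              (G.V.filter (fun v => v ∈ M k)).card := by
            refine (Finset.card_le_card ?_).trans (Finset.card_union_le _ _)
            intro v hv
            obtain ⟨hvV, m', hm', hvm⟩ := Finset.mem_filter.1 hv
            rw [Finset.mem_union]
            rcases Finset.mem_insert.1 hm' with rfl | hm'
            · right; exact Finset.mem_filter.2 ⟨hvV, by rw [hk]; exact hvm⟩
            · left; exact Finset.mem_filter.2 ⟨hvV, m', hm', hvm⟩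
          omega
      · exact Or.inr h
  obtain ⟨T, hT, hT1, hT2⟩ : ∃ T' : Finset (Set (ℝ × ℝ)), ↑T' ⊆ MM ∧
      G.V.card ≤ 5 * (N T').card ∧ 5 * (N T').card ≤ 4 * G.V.card := by
    refine (hgreedy hMMfin.toFinset (by simp)).resolve_left fun h => ?_
    have : N hMMfin.toFinset = G.V := by
      refine Finset.filter_true_of_mem fun v hv => ?_
      obtain ⟨m, hm, hvm⟩ := hVM v hv
      exact ⟨m, by simpa using hm, hvm⟩
    rw [this] at h
    omega
  have hNV : N T ⊆ G.V := Finset.filter_subset _ _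
  have hcard : (G.V \ N T).card + (N T).card = G.V.card :=
    Finset.card_sdiff_add_card_eq_card hNV
  have hcl2 : ∀ m ∈ MM, ∀ v ∈ N T, v ∈ m → ∀ w ∈ G.V, w ∈ m → w ∈ N T := by
    intro m hm v hv hvm w hw hwm
    obtain ⟨hvV, m', hm', hvm'⟩ := Finset.mem_filter.1 hv
    have := hdisj m hm m' (hT hm') ⟨v, hvm, hvm'⟩
    exact Finset.mem_filter.2 ⟨hw, m', hm', this ▸ hwm⟩
  have hcl1 : ∀ m ∈ MM, ∀ v ∈ G.V \ N T, v ∈ m → ∀ w ∈ G.V, w ∈ m → w ∈ G.V \ N T := by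
    intro m hm v hv hvm w hw hwm
    rw [Finset.mem_sdiff] at hv ⊢
    exact ⟨hw, fun h => hv.2 (hcl2 m hm w h hwm v hv.1 hvm)⟩
  apply hA
  refine width_le hsc hsep D₀ (G.V \ N T) (N T) Finset.sdiff_disjoint
    (Finset.sdiff_union_of_subset hNV) ?_ ?_ ?_ (hside _ Finset.sdiff_subset (by omega) hcl1)
    (hside _ hNV hT1 hcl2)
  · rw [le_div_iff₀ (by norm_num)]
    have : (G.V \ N T).card * 5 ≤ 4 * G.V.card := by omega
    exact_mod_cast this
  · rw [le_div_iff₀ (by norm_num)]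
    have : (N T).card * 5 ≤ 4 * G.V.card := by omega
    exact_mod_cast this
  · intro e he
    obtain ⟨m, hm, hem⟩ := hEM e he
    have h0 : G.arc e 0 ∈ G.endpoints e := by simp [endpoints]
    have hVe := endpoints_subset_V e
    have hre := endpoints_subset_range e
    by_cases h : G.arc e 0 ∈ N T
    · right
      exact fun w hw => hcl2 m hm _ h (hem ⟨0, rfl⟩) w (hVe hw) (hem (hre hw))
    · left
      exact fun w hw => hcl1 m hm _ (Finset.mem_sdiff.2 ⟨hVe h0, h⟩) (hem ⟨0, rfl⟩) w (hVe hw)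
        (hem (hre hw))

end TopMultigraph


/-! ### Nonplanarity of the complete graph on five vertices -/

lemma lift_change {g h : ℝ → ℂ} (hg : Continuous g) (hh : Continuous h)
    (he : ∀ s, Complex.exp (g s) = Complex.exp (h s)) (a b : ℝ) : g b - g a = h b - h a := by
  have := exp_lift_unique (A := (univ : Set ℝ)) isPreconnected_univ hg.continuousOn
    hh.continuousOn (fun z _ => he z) (mem_univ a) (mem_univ b)
  linear_combination -this

lemma k5_parity (n : Fin 5 → Fin 5 → Fin 5 → ℤ)
    (h : ∀ i j k l : Fin 5, i ≠ j → i ≠ k → i ≠ l → j ≠ k → j ≠ l → k ≠ l →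
      (if k < j then (-1 : ℤ) else 1) + (if j < l then (-1 : ℤ) else 1)
      + (if l < i then (-1 : ℤ) else 1) + (if i < k then (-1 : ℤ) else 1)
      + 2 * (n k i j + n j k l - n l i j - n i k l) = 0) : False := by
  have h1 := h 0 1 2 3 (by decide) (by decide) (by decide) (by decide) (by decide) (by decide)
  have h2 := h 0 1 2 4 (by decide) (by decide) (by decide) (by decide) (by decide) (by decide)
  have h3 := h 0 1 3 4 (by decide) (by decide) (by decide) (by decide) (by decide) (by decide)
  have h4 := h 0 2 1 3 (by decide) (by decide) (by decide) (by decide) (by decide) (by decide)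
  have h5 := h 0 2 1 4 (by decide) (by decide) (by decide) (by decide) (by decide) (by decide)
  have h6 := h 0 2 3 4 (by decide) (by decide) (by decide) (by decide) (by decide) (by decide)
  have h7 := h 0 3 1 2 (by decide) (by decide) (by decide) (by decide) (by decide) (by decide)
  have h8 := h 0 3 1 4 (by decide) (by decide) (by decide) (by decide) (by decide) (by decide)
  have h9 := h 0 3 2 4 (by decide) (by decide) (by decide) (by decide) (by decide) (by decide)
  have h10 := h 0 4 1 2 (by decide) (by decide) (by decide) (by decide) (by decide) (by decide)
  have h11 := h 0 4 1 3 (by decide) (by decide) (by decide) (by decide) (by decide) (by decide)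
  have h12 := h 0 4 2 3 (by decide) (by decide) (by decide) (by decide) (by decide) (by decide)
  have h13 := h 1 2 3 4 (by decide) (by decide) (by decide) (by decide) (by decide) (by decide)
  have h14 := h 1 3 2 4 (by decide) (by decide) (by decide) (by decide) (by decide) (by decide)
  have h15 := h 1 4 2 3 (by decide) (by decide) (by decide) (by decide) (by decide) (by decide)
  simp (decide := true) only [if_true, if_false] at h1 h2 h3 h4 h5 h6 h7 h8 h9 h10 h11 h12 h13 h14 h15
  omega

theorem no_k5 (x : Fin 5 → ℂ) (γ : Fin 5 → Fin 5 → ℝ → ℂ)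
    (hc : ∀ i j, i ≠ j → Continuous (γ i j)) (h0 : ∀ i j, i ≠ j → γ i j 0 = x i)
    (h1 : ∀ i j, i ≠ j → γ i j 1 = x j)
    (hd : ∀ i j k l : Fin 5, i ≠ j → i ≠ k → i ≠ l → j ≠ k → j ≠ l → k ≠ l →
      ∀ s t, γ i j s ≠ γ k l t) : False := by
  have hx : ∀ a b, a ≠ b → x b - x a ≠ 0 := by
    intro a b hab h
    obtain ⟨c, d, h2, h3, h4, h5, h6⟩ : ∃ c d : Fin 5, b ≠ c ∧ b ≠ d ∧ c ≠ a ∧ c ≠ d ∧ a ≠ d := by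
      clear h
      revert a b; decide
    refine hd b c a d h2 (Ne.symm hab) h3 h4 h5 h6 0 0 ?_
    rw [h0 b c h2, h0 a d h6]
    exact sub_eq_zero.1 h
  have hw : ∀ k i j, k ≠ i → k ≠ j → i ≠ j → ∃ L : ℝ → ℂ, Continuous L ∧
      ∀ s, Complex.exp (L s) = γ i j s - x k := by
    intro k i j hki hkj hij
    refine exists_lift_exp _ ((hc i j hij).sub continuous_const) fun s h => ?_
    obtain ⟨l, hl1, hl2, hl3⟩ : ∃ l : Fin 5, i ≠ l ∧ j ≠ l ∧ k ≠ l := by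
      clear h hki hkj hij
      revert i j k; decide
    refine hd i j k l hij (Ne.symm hki) hl1 (Ne.symm hkj) hl2 hl3 s 0 ?_
    rw [h0 k l hl3]
    exact sub_eq_zero.1 h
  choose! L hLc hLe using hw
  obtain ⟨θ, hθ, hθs⟩ : ∃ θ : Fin 5 → Fin 5 → ℂ,
      (∀ a b, a ≠ b → Complex.exp (θ a b) = x b - x a) ∧
      ∀ a b, a ≠ b → θ a b - θ b a = ((if a < b then (-1 : ℤ) else 1 : ℤ) : ℂ) *
        (Real.pi * Complex.I) := by
    refine ⟨fun a b => if a < b then Complex.log (x b - x a) else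
      Complex.log (x a - x b) + Real.pi * Complex.I, fun a b hab => ?_, fun a b hab => ?_⟩
    · by_cases h : a < b
      · simp only [if_pos h]
        rw [Complex.exp_log (hx a b hab)]
      · simp only [if_neg h]
        rw [Complex.exp_add, Complex.exp_log (hx b a hab.symm), Complex.exp_pi_mul_I]
        ring
    · rcases lt_or_gt_of_ne hab with h | h
      · simp only [if_pos h, if_neg (not_lt.2 h.le)]
        push_cast; ring
      · simp only [if_pos h, if_neg (not_lt.2 h.le)]
        push_cast; ring
  have hn : ∀ k i j, k ≠ i → k ≠ j → i ≠ j → ∃ m : ℤ, L k i j 1 - L k i j 0 =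
      θ k j - θ k i + m * (2 * Real.pi * Complex.I) := by
    intro k i j hki hkj hij
    have e1 : Complex.exp (L k i j 1) = Complex.exp (θ k j) := by
      rw [hLe k i j hki hkj hij, hθ k j hkj, h1 i j hij]
    have e0 : Complex.exp (L k i j 0) = Complex.exp (θ k i) := by
      rw [hLe k i j hki hkj hij, hθ k i hki, h0 i j hij]
    obtain ⟨m1, hm1⟩ := Complex.exp_eq_exp_iff_exists_int.1 e1
    obtain ⟨m0, hm0⟩ := Complex.exp_eq_exp_iff_exists_int.1 e0
    refine ⟨m1 - m0, ?_⟩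
    rw [hm1, hm0]; push_cast; ring
  choose! n hn using hn
  refine k5_parity n fun i j k l hij hik hil hjk hjl hkl => ?_
  obtain ⟨Λ, hΛ, hΛe⟩ := exists_lift_exp (fun p : ℝ × ℝ => γ i j p.1 - γ k l p.2)
    (((hc i j hij).comp continuous_fst).sub ((hc k l hkl).comp continuous_snd))
    (fun p h => hd i j k l hij hik hil hjk hjl hkl p.1 p.2 (sub_eq_zero.1 h))
  have c1 : ∀ t, Continuous fun s : ℝ => Λ (s, t) := fun t => hΛ.comp (by fun_prop)
  have c2 : ∀ s, Continuous fun t : ℝ => Λ (s, t) := fun s => hΛ.comp (by fun_prop)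
  have e1 := lift_change (c1 0) (hLc k i j hik.symm hjk.symm hij) (fun s => by
    rw [hΛe, hLe k i j hik.symm hjk.symm hij, h0 k l hkl]) 0 1
  have e2 := lift_change (c1 1) (hLc l i j hil.symm hjl.symm hij) (fun s => by
    rw [hΛe, hLe l i j hil.symm hjl.symm hij, h1 k l hkl]) 0 1
  have e3 := lift_change (h := fun s => L i k l s + Real.pi * Complex.I) (c2 0)
    ((hLc i k l hik hil hkl).add continuous_const) (fun s => by
    rw [hΛe, Complex.exp_add, Complex.exp_pi_mul_I, hLe i k l hik hil hkl, h0 i j hij]; ring) 0 1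
  have e4 := lift_change (h := fun s => L j k l s + Real.pi * Complex.I) (c2 1)
    ((hLc j k l hjk hjl hkl).add continuous_const) (fun s => by
    rw [hΛe, Complex.exp_add, Complex.exp_pi_mul_I, hLe j k l hjk hjl hkl, h1 i j hij]; ring) 0 1
  have n1 := hn k i j hik.symm hjk.symm hij
  have n2 := hn l i j hil.symm hjl.symm hij
  have n3 := hn i k l hik hil hkl
  have n4 := hn j k l hjk hjl hkl
  have t1 := hθs k j hjk.symm
  have t2 := hθs j l hjl
  have t3 := hθs l i hil.symm
  have t4 := hθs i k hik
  have key : (((if k < j then (-1 : ℤ) else 1) + (if j < l then (-1 : ℤ) else 1)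
      + (if l < i then (-1 : ℤ) else 1) + (if i < k then (-1 : ℤ) else 1)
      + 2 * (n k i j + n j k l - n l i j - n i k l) : ℤ) : ℂ) * (Real.pi * Complex.I) = 0 := by
    simp only [Int.cast_add, Int.cast_mul, Int.cast_sub, Int.cast_ofNat]
    linear_combination -t1 - t2 - t3 - t4 - n1 - n4 + n2 + n3 - e1 + e2 + e3 - e4
  have hpi : (Real.pi * Complex.I : ℂ) ≠ 0 :=
    mul_ne_zero (by exact_mod_cast Real.pi_ne_zero) Complex.I_ne_zero
  exact_mod_cast (mul_eq_zero.1 key).resolve_right hpi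


/-! ### Havens and complete minors in finite weighted graphs -/

section Haven
open Classical

variable {P : Type*} [DecidableEq P] (adj : P → P → Prop)

/-- A nonempty connected vertex set. -/
def Conn (K : Finset P) : Prop :=
  K.Nonempty ∧ ∀ A ⊆ K, A.Nonempty → (∀ a ∈ A, ∀ b ∈ K, adj a b → b ∈ A) → K ⊆ A

variable {adj}

lemma conn_singleton (v : P) : Conn adj {v} := by
  refine ⟨Finset.singleton_nonempty v, fun A hA hn _ => ?_⟩
  obtain ⟨a, ha⟩ := hn
  have := Finset.mem_singleton.1 (hA ha)
  subst this
  simpa using ha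

/-- Propagation along a connected set. -/
lemma Conn.prop {K : Finset P} (hK : Conn adj K) (p : P → Prop) {a : P} (ha : a ∈ K) (hp : p a)
    (h : ∀ a ∈ K, ∀ b ∈ K, adj a b → p a → p b) : ∀ b ∈ K, p b := by
  intro b hb
  have := hK.2 (K.filter p) (Finset.filter_subset _ _) ⟨a, Finset.mem_filter.2 ⟨ha, hp⟩⟩
    (fun x hx y hy hxy => Finset.mem_filter.2 ⟨hy, h x (Finset.mem_filter.1 hx).1 y hy hxy
      (Finset.mem_filter.1 hx).2⟩)
  exact (Finset.mem_filter.1 (this hb)).2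

lemma conn_center {U : Finset P} {x : P} (hx : x ∈ U)
    (h : ∀ y ∈ U, ∃ K ⊆ U, Conn adj K ∧ x ∈ K ∧ y ∈ K) : Conn adj U := by
  refine ⟨⟨x, hx⟩, fun A hA hn hcl => ?_⟩
  obtain ⟨a, ha⟩ := hn
  have key : ∀ K ⊆ U, Conn adj K → ∀ u ∈ K, u ∈ A → ∀ w ∈ K, w ∈ A := by
    intro K hKU hK u hu huA
    exact hK.prop (fun z => z ∈ A) hu huA (fun z hz w hw hzw hzA => hcl z hzA w (hKU hw) hzw)
  obtain ⟨K, hKU, hK, hxK, haK⟩ := h a (hA ha)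
  have hxA := key K hKU hK a haK ha x hxK
  intro y hy
  obtain ⟨L, hLU, hL, hxL, hyL⟩ := h y hy
  exact key L hLU hL x hxL hxA y hyL

lemma conn_union {K L : Finset P} (hK : Conn adj K) (hL : Conn adj L) {x : P} (hxK : x ∈ K)
    (hxL : x ∈ L) : Conn adj (K ∪ L) := by
  refine conn_center (x := x) (Finset.mem_union_left _ hxK) fun y hy => ?_
  rcases Finset.mem_union.1 hy with h | h
  · exact ⟨K, Finset.subset_union_left, hK, hxK, h⟩
  · exact ⟨L, Finset.subset_union_right, hL, hxL, h⟩

lemma conn_pair (hs : ∀ a b, adj a b → adj b a) {a b : P} (hab : adj a b) :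
    Conn adj {a, b} := by
  refine ⟨⟨a, by simp⟩, fun A hA hn hcl => ?_⟩
  obtain ⟨x, hx⟩ := hn
  have hxab := hA hx
  simp only [Finset.mem_insert, Finset.mem_singleton] at hxab
  rcases hxab with rfl | rfl
  · have := hcl x hx b (by simp) hab
    intro y hy
    simp only [Finset.mem_insert, Finset.mem_singleton] at hy
    rcases hy with rfl | rfl <;> assumption
  · have := hcl x hx a (by simp) (hs _ _ hab)
    intro y hy
    simp only [Finset.mem_insert, Finset.mem_singleton] at hy
    rcases hy with rfl | rfl <;> assumption

lemma conn_union_adj (hs : ∀ a b, adj a b → adj b a) {K L : Finset P} (hK : Conn adj K)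
    (hL : Conn adj L) {a b : P} (ha : a ∈ K) (hb : b ∈ L) (hab : adj a b) :
    Conn adj (K ∪ L) := by
  have h1 := conn_union hK (conn_pair hs hab) ha (by simp)
  have h2 := conn_union h1 hL (x := b) (by simp) hb
  have : K ∪ {a, b} ∪ L = K ∪ L := by
    ext y
    simp only [Finset.mem_union, Finset.mem_insert, Finset.mem_singleton]
    constructor
    · rintro ((h | rfl | rfl) | h) <;> simp_all
    · rintro (h | h) <;> simp_all
  rwa [this] at h2

/-- The component of `v` in `F`. -/
noncomputable def comp (adj : P → P → Prop) (F : Finset P) (v : P) : Finset P :=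
  F.filter fun w => ∃ K ⊆ F, Conn adj K ∧ v ∈ K ∧ w ∈ K

lemma comp_subset (F : Finset P) (v : P) : comp adj F v ⊆ F := Finset.filter_subset _ _

lemma mem_comp_self {F : Finset P} {v : P} (hv : v ∈ F) : v ∈ comp adj F v :=
  Finset.mem_filter.2 ⟨hv, {v}, by simpa using hv, conn_singleton v, by simp, by simp⟩

lemma comp_conn {F : Finset P} {v : P} (hv : v ∈ F) : Conn adj (comp adj F v) := by
  refine conn_center (x := v) (mem_comp_self hv) fun y hy => ?_
  obtain ⟨_, K, hKF, hK, hvK, hyK⟩ := Finset.mem_filter.1 hy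
  exact ⟨K, fun z hz => Finset.mem_filter.2 ⟨hKF hz, K, hKF, hK, hvK, hz⟩, hK, hvK, hyK⟩

lemma comp_max {F : Finset P} {v x : P} {K : Finset P} (hK : Conn adj K)
    (hKF : K ⊆ F) (hxK : x ∈ K) (hx : x ∈ comp adj F v) : K ⊆ comp adj F v := by
  obtain ⟨_, L, hLF, hL, hvL, hxL⟩ := Finset.mem_filter.1 hx
  intro y hy
  exact Finset.mem_filter.2 ⟨hKF hy, L ∪ K, Finset.union_subset hLF hKF,
    conn_union hL hK hxL hxK, Finset.mem_union_left _ hvL, Finset.mem_union_right _ hy⟩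

/-- The tree-or-separator lemma. -/
lemma tree_or_sep (hs : ∀ a b, adj a b → adj b a) (c : P → ℕ) (N r : ℕ) (B : Finset P)
    (hN : ∑ v ∈ B, c v ^ 2 ≤ N) (hr : ∀ v ∈ B, c v ≤ r) (hB : Conn adj B) (A : ℕ → Finset P)
    (k : ℕ) (hk : k ≤ 4) (hA : ∀ i < k, ∃ a ∈ A i, a ∈ B) :
    (∃ T ⊆ B, Conn adj T ∧ (∀ i < k, ∃ a ∈ A i, a ∈ T) ∧ ∑ v ∈ T, c v ≤ r) ∨
    ∃ Z ⊆ B, (∑ v ∈ Z, c v) * (r + 1) ≤ 3 * N ∧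
      ∀ K ⊆ B, Disjoint K Z → Conn adj K → ∃ i < k, ∀ a ∈ A i, a ∉ K := by
  by_cases hT : ∃ T ⊆ B, Conn adj T ∧ (∀ i < k, ∃ a ∈ A i, a ∈ T) ∧ ∑ v ∈ T, c v ≤ r
  · exact Or.inl hT
  right
  rcases Nat.lt_or_ge k 2 with hk2 | hk2
  · exfalso
    apply hT
    interval_cases k
    · obtain ⟨v, hv⟩ := hB.1
      exact ⟨{v}, by simpa using hv, conn_singleton v, by simp, by simpa using hr v hv⟩
    · obtain ⟨v, hvA, hv⟩ := hA 0 (by norm_num)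
      refine ⟨{v}, by simpa using hv, conn_singleton v, ?_, by simpa using hr v hv⟩
      intro i hi
      obtain rfl : i = 0 := by omega
      exact ⟨v, hvA, by simp⟩
  obtain ⟨m, rfl⟩ : ∃ m, k = m + 2 := ⟨k - 2, by omega⟩
  -- minimal costs
  let S : ℕ → P → Set ℕ := fun i v => {x | ∃ T ⊆ B, Conn adj T ∧ v ∈ T ∧
    (∀ j ≤ i, ∃ a ∈ A j, a ∈ T) ∧ ∑ w ∈ T, c w = x}
  let f : ℕ → P → ℕ := fun i v => sInf (S i v)
  have hSn : ∀ i < m + 2, ∀ v ∈ B, f i v ∈ S i v := fun i hi v hv => Nat.sInf_mem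
    ⟨_, B, Finset.Subset.refl _, hB, hv, fun j hj => hA j (by omega), rfl⟩
  have f0 : ∀ a ∈ A 0, a ∈ B → f 0 a ≤ c a := fun a ha haB => Nat.sInf_le
    ⟨{a}, by simpa using haB, conn_singleton a, by simp, fun j hj => ⟨a, by
      obtain rfl : j = 0 := by omega
      exact ha, by simp⟩, by simp⟩
  have fs : ∀ i, i + 1 < m + 2 → ∀ a ∈ A (i + 1), a ∈ B → f (i + 1) a ≤ f i a := by
    intro i hi a ha haB
    obtain ⟨T, hTB, hT, haT, hTA, hTc⟩ := hSn i (by omega) a haB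
    refine Nat.sInf_le ⟨T, hTB, hT, haT, fun j hj => ?_, hTc⟩
    rcases Nat.lt_or_ge i j with h | h
    · obtain rfl : j = i + 1 := by omega
      exact ⟨a, ha, haT⟩
    · exact hTA j h
  have fa : ∀ i < m + 2, ∀ v ∈ B, ∀ w ∈ B, adj v w → f i w ≤ f i v + c w := by
    intro i hi v hv w hw hvw
    obtain ⟨T, hTB, hT, hvT, hTA, hTc⟩ := hSn i hi v hv
    have h1 : f i w ≤ ∑ u ∈ T ∪ {w}, c u := Nat.sInf_le ⟨T ∪ {w}, Finset.union_subset hTB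
      (by simpa using hw), conn_union_adj hs hT (conn_singleton w) hvT (by simp) hvw, by simp,
      fun j hj => by
        obtain ⟨a, ha, haT⟩ := hTA j hj
        exact ⟨a, ha, Finset.mem_union_left _ haT⟩, rfl⟩
    have h2 : ∑ u ∈ T ∪ {w}, c u ≤ ∑ u ∈ T, c u + ∑ u ∈ {w}, c u := by
      rw [← Finset.sum_union_inter]; omega
    rw [Finset.sum_singleton, hTc] at h2
    exact h1.trans h2
  have fl : ∀ v ∈ B, r + 1 ≤ f (m + 1) v := by
    intro v hv
    by_contra hlt
    obtain ⟨T, hTB, hTc, hvT, hTA, hTs⟩ := hSn (m + 1) (by omega) v hv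
    exact hT ⟨T, hTB, hTc, fun i hi => hTA i (by omega), by omega⟩
  obtain ⟨Z, hZ⟩ : ∃ Z : ℕ → Finset P, ∀ t v, v ∈ Z t ↔ v ∈ B ∧ ∃ i ∈ Finset.range (m + 1),
      t ≤ f i v ∧ f i v < t + c v :=
    ⟨fun t => B.filter fun v => ∃ i ∈ Finset.range (m + 1), t ≤ f i v ∧ f i v < t + c v,
      fun t v => by simp only [Finset.mem_filter]⟩
  have hsep : ∀ t, 1 ≤ t → t ≤ r + 1 → ∀ K ⊆ B, Disjoint K (Z t) → Conn adj K →
      ∃ i < m + 2, ∀ a ∈ A i, a ∉ K := by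
    intro t ht1 ht2 K hKB hKZ hK
    by_contra hcon
    push Not at hcon
    have hz : ∀ v ∈ K, ∀ i ≤ m, f i v < t + c v → f i v < t := by
      intro v hv i hi h
      by_contra hge
      exact Finset.disjoint_left.1 hKZ hv ((hZ _ _).2 ⟨hKB hv, i,
        Finset.mem_range.2 (by omega), by omega, h⟩)
    have hall : ∀ i ≤ m, ∀ v ∈ K, f i v < t := by
      intro i
      induction i with
      | zero =>
        intro hi
        obtain ⟨a, haA, haK⟩ := hcon 0 (by omega)
        refine hK.prop (fun v => f 0 v < t) haK (hz a haK 0 hi ?_) ?_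
        · have := f0 a haA (hKB haK); omega
        · intro v hv w hw hvw h
          refine hz w hw 0 hi ?_
          have := fa 0 (by omega) v (hKB hv) w (hKB hw) hvw; omega
      | succ i ih =>
        intro hi
        obtain ⟨a, haA, haK⟩ := hcon (i + 1) (by omega)
        refine hK.prop (fun v => f (i + 1) v < t) haK ?_ ?_
        · have := fs i (by omega) a haA (hKB haK)
          have := ih (by omega) a haK
          omega
        · intro v hv w hw hvw h
          refine hz w hw (i + 1) hi ?_
          have := fa (i + 1) (by omega) v (hKB hv) w (hKB hw) hvw; omega
    obtain ⟨a, haA, haK⟩ := hcon (m + 1) (by omega)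
    have h1 := fs m (by omega) a haA (hKB haK)
    have h2 := hall m le_rfl a haK
    have h3 := fl a (hKB haK)
    omega
  have hsum : ∑ t ∈ Finset.Icc 1 (r + 1), ∑ v ∈ Z t, c v ≤ (m + 1) * N := by
    calc ∑ t ∈ Finset.Icc 1 (r + 1), ∑ v ∈ Z t, c v
        ≤ ∑ t ∈ Finset.Icc 1 (r + 1), ∑ i ∈ Finset.range (m + 1), ∑ v ∈ B,
          (if t ≤ f i v ∧ f i v < t + c v then c v else 0) := by
          refine Finset.sum_le_sum fun t _ => ?_
          have hZt : Z t = B.filter fun v => ∃ i ∈ Finset.range (m + 1),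
              t ≤ f i v ∧ f i v < t + c v := by
            ext v; rw [hZ]; simp only [Finset.mem_filter]
          rw [Finset.sum_comm, hZt, Finset.sum_filter]
          refine Finset.sum_le_sum fun v _ => ?_
          split_ifs with h
          · obtain ⟨i, hi, h⟩ := h
            have := Finset.single_le_sum (f := fun i => if t ≤ f i v ∧ f i v < t + c v then c v
              else 0) (fun _ _ => Nat.zero_le _) hi
            simpa [h] using this
          · exact Nat.zero_le _
      _ = ∑ i ∈ Finset.range (m + 1), ∑ v ∈ B, ∑ t ∈ Finset.Icc 1 (r + 1),
          (if t ≤ f i v ∧ f i v < t + c v then c v else 0) := by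
          rw [Finset.sum_comm]
          refine Finset.sum_congr rfl fun i _ => Finset.sum_comm
      _ ≤ ∑ i ∈ Finset.range (m + 1), ∑ v ∈ B, c v ^ 2 := by
          refine Finset.sum_le_sum fun i _ => Finset.sum_le_sum fun v _ => ?_
          rw [← Finset.sum_filter, Finset.sum_const, smul_eq_mul, sq]
          refine Nat.mul_le_mul_right _ ?_
          calc _ ≤ (Finset.Ioc (f i v - c v) (f i v)).card := Finset.card_le_card ?_
            _ ≤ c v := by rw [Nat.card_Ioc]; omega
          intro t ht
          simp only [Finset.mem_filter, Finset.mem_Icc] at ht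
          simp only [Finset.mem_Ioc]
          omega
      _ ≤ (m + 1) * N := by
          rw [Finset.sum_const, Finset.card_range, smul_eq_mul]
          exact Nat.mul_le_mul_left _ hN
  obtain ⟨t, ht, htc⟩ : ∃ t ∈ Finset.Icc 1 (r + 1), (∑ v ∈ Z t, c v) * (r + 1) ≤ (m + 1) * N := by
    by_contra hcon
    push Not at hcon
    have h1 : ∑ t ∈ Finset.Icc 1 (r + 1), (m + 1) * N <
        ∑ t ∈ Finset.Icc 1 (r + 1), (∑ v ∈ Z t, c v) * (r + 1) :=
      Finset.sum_lt_sum_of_nonempty ⟨1, by simp⟩ hcon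
    rw [← Finset.sum_mul _ _ (r + 1), Finset.sum_const, Nat.card_Icc, smul_eq_mul] at h1
    simp only [Nat.add_sub_cancel] at h1
    have h2 := Nat.mul_le_mul_right (r + 1) hsum
    linarith
  rw [Finset.mem_Icc] at ht
  refine ⟨Z t, fun v hv => ((hZ _ _).1 hv).1, htc.trans (Nat.mul_le_mul_right _ (by omega)),
    hsep t ht.1 ht.2⟩

end Haven


section Haven
open Classical

variable {P : Type*} [DecidableEq P] {adj : P → P → Prop}

/-- A haven of order `b` with respect to the cost `c`. -/
structure IsHaven (adj : P → P → Prop) (c : P → ℕ) (b : ℕ) (β : Finset P → Finset P) : Prop where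
  conn : ∀ S, ∑ v ∈ S, c v ≤ b → Conn adj (β S)
  disj : ∀ S, ∑ v ∈ S, c v ≤ b → Disjoint (β S) S
  maxi : ∀ S, ∑ v ∈ S, c v ≤ b → ∀ K, Conn adj K → Disjoint K S → ∀ x ∈ K, x ∈ β S → K ⊆ β S
  touch : ∀ S S', ∑ v ∈ S, c v ≤ b → ∑ v ∈ S', c v ≤ b → ∃ x ∈ β S, x ∈ β S'

/-- A family of disjoint, connected, pairwise adjacent sets. -/
structure Covey (adj : P → P → Prop) (C : Finset (Finset P)) : Prop where
  conn : ∀ K ∈ C, Conn adj K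
  disj : ∀ K ∈ C, ∀ L ∈ C, K ≠ L → Disjoint K L
  adja : ∀ K ∈ C, ∀ L ∈ C, K ≠ L → ∃ a ∈ K, ∃ b ∈ L, adj a b

lemma IsHaven.anti {c : P → ℕ} {b : ℕ} {β : Finset P → Finset P} (h : IsHaven adj c b β)
    {S S' : Finset P} (hS' : ∑ v ∈ S', c v ≤ b) (hSS : S ⊆ S') : β S' ⊆ β S := by
  have hS : ∑ v ∈ S, c v ≤ b := (Finset.sum_le_sum_of_subset hSS).trans hS'
  obtain ⟨x, hx, hx'⟩ := h.touch S S' hS hS'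
  exact h.maxi S hS _ (h.conn S' hS') ((h.disj S' hS').mono_right hSS) x hx' hx

lemma IsHaven.step {c : P → ℕ} {b : ℕ} {β : Finset P → Finset P} (h : IsHaven adj c b β)
    (hs : ∀ a b, adj a b → adj b a)
    {S : Finset P} (hS : ∑ v ∈ S, c v ≤ b) {x y : P} (hx : x ∈ β S) (hxy : adj x y)
    (hy : y ∉ S) : y ∈ β S := by
  refine h.maxi S hS {x, y} (conn_pair hs hxy) ?_ x (by simp) hx (by simp)
  rw [Finset.disjoint_left]
  intro z hz
  simp only [Finset.mem_insert, Finset.mem_singleton] at hz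
  rcases hz with rfl | rfl
  · exact Finset.disjoint_left.1 (h.disj S hS) hx
  · exact hy

lemma sum_biUnion_le' {α : Type*} (c : P → ℕ) (s : Finset α) (t : α → Finset P) :
    ∑ v ∈ s.biUnion t, c v ≤ ∑ K ∈ s, ∑ v ∈ t K, c v := by
  induction s using Finset.induction_on with
  | empty => simp
  | insert a s ha ih =>
    rw [Finset.biUnion_insert, Finset.sum_insert ha]
    have : ∑ v ∈ t a ∪ s.biUnion t, c v ≤ ∑ v ∈ t a, c v + ∑ v ∈ s.biUnion t, c v := by
      rw [← Finset.sum_union_inter]; omega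
    omega

lemma cost_le {c : P → ℕ} {r : ℕ} {C : Finset (Finset P)} {X : Finset P}
    (hX : ∀ x ∈ X, ∃ K ∈ C, x ∈ K) (hr : ∀ K ∈ C, ∑ v ∈ X ∩ K, c v ≤ r) :
    ∑ v ∈ X, c v ≤ C.card * r := by
  have h1 : X ⊆ C.biUnion fun K => X ∩ K := fun x hx => by
    obtain ⟨K, hK, hxK⟩ := hX x hx
    exact Finset.mem_biUnion.2 ⟨K, hK, Finset.mem_inter.2 ⟨hx, hxK⟩⟩
  calc ∑ v ∈ X, c v ≤ ∑ v ∈ C.biUnion fun K => X ∩ K, c v := Finset.sum_le_sum_of_subset h1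
    _ ≤ ∑ K ∈ C, ∑ v ∈ X ∩ K, c v := sum_biUnion_le' _ _ _
    _ ≤ ∑ K ∈ C, r := Finset.sum_le_sum hr
    _ = C.card * r := by simp

theorem haven_covey (hs : ∀ a b, adj a b → adj b a) (c : P → ℕ) (N r : ℕ)
    (hN : ∀ B : Finset P, ∑ v ∈ B, c v ^ 2 ≤ N) (hr : 3 * N < (r + 1) ^ 2)
    (β : Finset P → Finset P) (hβ : IsHaven adj c (5 * r) β) :
    ∃ C : Finset (Finset P), C.card = 5 ∧ Covey adj C := by
  have hcr : ∀ v, c v ≤ r := by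
    intro v
    have := hN {v}
    rw [Finset.sum_singleton] at this
    by_contra h
    have : r + 1 ≤ c v := by omega
    nlinarith [Nat.pow_le_pow_left this 2]
  suffices H : ∀ n : ℕ, ∀ (C : Finset (Finset P)) (X : Finset P), C.card + X.card +
      3 * (β X).card ≤ n → C.card ≤ 4 → Covey adj C → (∀ x ∈ X, ∃ K ∈ C, x ∈ K) →
      (∀ K ∈ C, ∑ v ∈ X ∩ K, c v ≤ r) → (∀ K ∈ C, Disjoint K (β X)) →
      ∃ C : Finset (Finset P), C.card = 5 ∧ Covey adj C by
    exact H _ ∅ ∅ le_rfl (by simp) ⟨by simp, by simp, by simp⟩ (by simp) (by simp) (by simp)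
  intro n
  induction n with
  | zero =>
    intro C X hn hC4 hC hXC hXr hCβ
    exfalso
    have h1 := cost_le hXC hXr
    have h2 : ∑ v ∈ X, c v ≤ 5 * r := h1.trans (Nat.mul_le_mul_right _ (by omega))
    have := (hβ.conn X h2).1.card_pos
    omega
  | succ n ih =>
    intro C X hn hC4 hC hXC hXr hCβ
    have hX4 : ∑ v ∈ X, c v ≤ 4 * r := (cost_le hXC hXr).trans (Nat.mul_le_mul_right _ hC4)
    have hX5 : ∑ v ∈ X, c v ≤ 5 * r := by omega
    by_cases hstep : ∃ K ∈ C, ∀ a ∈ K, ∀ b ∈ β X, ¬ adj a b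
    · -- drop K
      obtain ⟨K, hK, hKn⟩ := hstep
      have hX'5 : ∑ v ∈ X \ K, c v ≤ 5 * r :=
        (Finset.sum_le_sum_of_subset Finset.sdiff_subset).trans hX5
      have hsub : β X ⊆ β (X \ K) := hβ.anti hX5 Finset.sdiff_subset
      have hsub' : β (X \ K) ⊆ β X := by
        obtain ⟨x, hx⟩ := (hβ.conn X hX5).1
        refine (hβ.conn _ hX'5).prop (fun v => v ∈ β X) (hsub hx) hx ?_
        intro a ha b hb hab haX
        refine hβ.step hs hX5 haX hab fun hbX => ?_
        by_cases hbK : b ∈ K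
        · exact hKn b hbK a haX (hs _ _ hab)
        · exact Finset.disjoint_left.1 (hβ.disj _ hX'5) hb (Finset.mem_sdiff.2 ⟨hbX, hbK⟩)
      have heq : β (X \ K) = β X := Finset.Subset.antisymm hsub' hsub
      have hcard := Finset.card_erase_add_one hK
      refine ih (C.erase K) (X \ K) ?_ (by omega) ?_ ?_ ?_ ?_
      · rw [heq]
        have := Finset.card_le_card (Finset.sdiff_subset (s := X) (t := K))
        omega
      · exact ⟨fun L hL => hC.conn L (Finset.mem_of_mem_erase hL),
          fun L hL M hM => hC.disj L (Finset.mem_of_mem_erase hL) M (Finset.mem_of_mem_erase hM),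
          fun L hL M hM => hC.adja L (Finset.mem_of_mem_erase hL) M (Finset.mem_of_mem_erase hM)⟩
      · intro x hx
        obtain ⟨hxX, hxK⟩ := Finset.mem_sdiff.1 hx
        obtain ⟨L, hL, hxL⟩ := hXC x hxX
        exact ⟨L, Finset.mem_erase.2 ⟨fun h => hxK (h ▸ hxL), hL⟩, hxL⟩
      · intro L hL
        exact (Finset.sum_le_sum_of_subset (Finset.inter_subset_inter_right
          Finset.sdiff_subset)).trans (hXr L (Finset.mem_of_mem_erase hL))
      · intro L hL
        rw [heq]
        exact hCβ L (Finset.mem_of_mem_erase hL)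
    push Not at hstep
    -- enumerate the family
    obtain ⟨g, hg1, hg2⟩ : ∃ g : ℕ → Finset P, (∀ i < C.card, g i ∈ C) ∧
        ∀ K ∈ C, ∃ i < C.card, g i = K := by
      refine ⟨fun i => if h : i < C.card then (C.equivFin.symm ⟨i, h⟩ : Finset P) else ∅,
        fun i hi => by simp [hi], fun K hK => ⟨C.equivFin ⟨K, hK⟩, (C.equivFin ⟨K, hK⟩).2, by simp⟩⟩
    rcases tree_or_sep hs c N r (β X) (hN _) (fun v _ => hcr v) (hβ.conn X hX5)
      (fun i => (β X).filter fun b => ∃ a ∈ g i, adj a b) C.card hC4 (fun i hi => by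
        obtain ⟨a, ha, b, hb, hab⟩ := hstep _ (hg1 i hi)
        exact ⟨b, Finset.mem_filter.2 ⟨hb, a, ha, hab⟩, hb⟩) with
      ⟨T, hTB, hT, hTA, hTc⟩ | ⟨Z, hZB, hZc, hZs⟩
    · -- add T
      have hTne : T ∉ C := fun hTC => by
        obtain ⟨x, hx⟩ := hT.1
        exact Finset.disjoint_left.1 (hCβ T hTC) hx (hTB hx)
      have hTd : ∀ K ∈ C, Disjoint K T := fun K hK => (hCβ K hK).mono_right hTB
      have hTa : ∀ K ∈ C, ∃ a ∈ K, ∃ b ∈ T, adj a b := by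
        intro K hK
        obtain ⟨i, hi, rfl⟩ := hg2 K hK
        obtain ⟨b, hb, hbT⟩ := hTA i hi
        obtain ⟨_, a, ha, hab⟩ := Finset.mem_filter.1 hb
        exact ⟨a, ha, b, hbT, hab⟩
      have hcov : Covey adj (insert T C) := by
        refine ⟨?_, ?_, ?_⟩
        · intro K hK
          rcases Finset.mem_insert.1 hK with rfl | hK
          · exact hT
          · exact hC.conn K hK
        · intro K hK L hL hKL
          rcases Finset.mem_insert.1 hK with rfl | hK' <;>
            rcases Finset.mem_insert.1 hL with rfl | hL'
          · exact absurd rfl hKL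
          · exact (hTd L hL').symm
          · exact hTd K hK'
          · exact hC.disj K hK' L hL' hKL
        · intro K hK L hL hKL
          rcases Finset.mem_insert.1 hK with rfl | hK' <;>
            rcases Finset.mem_insert.1 hL with rfl | hL'
          · exact absurd rfl hKL
          · obtain ⟨a, ha, b, hb, hab⟩ := hTa L hL'
            exact ⟨b, hb, a, ha, hs _ _ hab⟩
          · exact hTa K hK'
          · exact hC.adja K hK' L hL' hKL
      have hcard := Finset.card_insert_of_notMem hTne
      by_cases hC5 : (insert T C).card = 5
      · exact ⟨_, hC5, hcov⟩
      have hX'5 : ∑ v ∈ X ∪ T, c v ≤ 5 * r := by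
        have : ∑ v ∈ X ∪ T, c v ≤ ∑ v ∈ X, c v + ∑ v ∈ T, c v := by
          rw [← Finset.sum_union_inter]; omega
        omega
      have hsub : β (X ∪ T) ⊆ β X := hβ.anti hX'5 Finset.subset_union_left
      have hdT : Disjoint (β (X ∪ T)) T := (hβ.disj _ hX'5).mono_right Finset.subset_union_right
      have hXβ : Disjoint (β X) X := hβ.disj X hX5
      refine ih (insert T C) (X ∪ T) ?_ (by omega) hcov ?_ ?_ ?_
      · have h1 := Finset.card_le_card (Finset.union_subset hsub hTB)
        rw [Finset.card_union_of_disjoint hdT] at h1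
        have h2 := Finset.card_union_le X T
        have h3 := hT.1.card_pos
        omega
      · intro x hx
        rcases Finset.mem_union.1 hx with hx | hx
        · obtain ⟨K, hK, hxK⟩ := hXC x hx
          exact ⟨K, Finset.mem_insert_of_mem hK, hxK⟩
        · exact ⟨T, Finset.mem_insert_self _ _, hx⟩
      · intro K hK
        rcases Finset.mem_insert.1 hK with rfl | hK
        · exact (Finset.sum_le_sum_of_subset Finset.inter_subset_right).trans hTc
        · refine (Finset.sum_le_sum_of_subset ?_).trans (hXr K hK)
          intro x hx
          obtain ⟨hx1, hx2⟩ := Finset.mem_inter.1 hx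
          rcases Finset.mem_union.1 hx1 with h | h
          · exact Finset.mem_inter.2 ⟨h, hx2⟩
          · exact absurd h (Finset.disjoint_left.1 (hTd K hK) hx2)
      · intro K hK
        rcases Finset.mem_insert.1 hK with rfl | hK
        · exact hdT.symm
        · exact (hCβ K hK).mono_right hsub
    · -- a small separator Z
      have hZr : ∑ v ∈ Z, c v ≤ r := by
        by_contra hlt
        have h1 : r + 1 ≤ ∑ v ∈ Z, c v := by omega
        have h2 := Nat.mul_le_mul_right (r + 1) h1
        nlinarith
      have hXZ5 : ∑ v ∈ X ∪ Z, c v ≤ 5 * r := by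
        have : ∑ v ∈ X ∪ Z, c v ≤ ∑ v ∈ X, c v + ∑ v ∈ Z, c v := by
          rw [← Finset.sum_union_inter]; omega
        omega
      have hXβ : Disjoint (β X) X := hβ.disj X hX5
      obtain ⟨B', hB'⟩ : ∃ B', B' = β (X ∪ Z) := ⟨_, rfl⟩
      have hB's : B' ⊆ β X := hB' ▸ hβ.anti hXZ5 Finset.subset_union_left
      have hB'c : Conn adj B' := hB' ▸ hβ.conn _ hXZ5
      have hB'd : Disjoint B' (X ∪ Z) := hB' ▸ hβ.disj _ hXZ5
      obtain ⟨i, hi, hiA⟩ := hZs B' hB's (hB'd.mono_right Finset.subset_union_right) hB'c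
      obtain ⟨K₁, hK₁⟩ : ∃ K₁, K₁ = g i := ⟨_, rfl⟩
      have hK₁C : K₁ ∈ C := hK₁ ▸ hg1 i hi
      have hmiss : ∀ a ∈ K₁, ∀ b ∈ β X, adj a b → b ∉ B' := fun a ha b hb hab =>
        hiA b (Finset.mem_filter.2 ⟨hb, a, hK₁ ▸ ha, hab⟩)
      clear hiA hZs hg1 hg2
      obtain ⟨Y, hY⟩ : ∃ Y : Finset P, ∀ y, y ∈ Y ↔ ∃ K ⊆ β X \ B', Conn adj K ∧ y ∈ K ∧
          ∃ a ∈ K₁, ∃ b ∈ K, adj a b := by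
        refine ⟨(β X \ B').filter fun y => ∃ K ⊆ β X \ B', Conn adj K ∧ y ∈ K ∧
          ∃ a ∈ K₁, ∃ b ∈ K, adj a b, fun y => ?_⟩
        rw [Finset.mem_filter]
        exact ⟨fun h => h.2, fun h => ⟨by obtain ⟨K, h1, h2, h3, _⟩ := h; exact h1 h3, h⟩⟩
      have hYs : Y ⊆ β X \ B' := fun y hy => by
        obtain ⟨K, h1, h2, h3, _⟩ := (hY y).1 hy
        exact h1 h3
      have hY1 : ∀ a ∈ K₁, ∀ b ∈ β X, adj a b → b ∈ Y := fun a ha b hb hab =>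
        (hY b).2 ⟨{b}, by simpa using ⟨hb, hmiss a ha b hb hab⟩, conn_singleton b, by simp,
          a, ha, b, by simp, hab⟩
      have hY2 : ∀ y ∈ Y, ∀ b ∈ β X, b ∉ B' → adj y b → b ∈ Y := by
        intro y hy b hb hbB hyb
        obtain ⟨K, h1, h2, h3, a, ha, z, hz, haz⟩ := (hY y).1 hy
        exact (hY b).2 ⟨K ∪ {b}, Finset.union_subset h1 (by simpa using ⟨hb, hbB⟩),
          conn_union_adj hs h2 (conn_singleton b) h3 (by simp) hyb, by simp, a, ha, z,
          Finset.mem_union_left _ hz, haz⟩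
      have hYne : Y.Nonempty := by
        obtain ⟨a, ha, b, hb, hab⟩ := hstep K₁ hK₁C
        exact ⟨b, hY1 a ha b hb hab⟩
      have hYX : ∀ y ∈ Y, y ∉ X := fun y hy =>
        Finset.disjoint_left.1 hXβ (Finset.mem_sdiff.1 (hYs hy)).1
      have hYβ : Y ⊆ β X := hYs.trans Finset.sdiff_subset
      have hYC : ∀ K ∈ C, Disjoint K Y := fun K hK => (hCβ K hK).mono_right hYβ
      have hconn : Conn adj (K₁ ∪ Y) := by
        obtain ⟨x, hx⟩ := (hC.conn K₁ hK₁C).1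
        refine conn_center (x := x) (Finset.mem_union_left _ hx) fun y hy => ?_
        rcases Finset.mem_union.1 hy with hy | hy
        · exact ⟨K₁, Finset.subset_union_left, hC.conn K₁ hK₁C, hx, hy⟩
        · obtain ⟨K, h1, h2, h3, a, ha, z, hz, haz⟩ := (hY y).1 hy
          refine ⟨K₁ ∪ K, Finset.union_subset_union_right fun w hw =>
            (hY w).2 ⟨K, h1, h2, hw, a, ha, z, hz, haz⟩, conn_union_adj hs (hC.conn K₁ hK₁C) h2
            ha hz haz, Finset.mem_union_left _ hx, Finset.mem_union_right _ h3⟩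
      obtain ⟨X', hX'⟩ : ∃ X', X' = (X \ K₁) ∪ (Z ∩ Y) := ⟨_, rfl⟩
      have hX'XZ : X' ⊆ X ∪ Z := hX' ▸ Finset.union_subset_union Finset.sdiff_subset
        Finset.inter_subset_left
      have hX'5 : ∑ v ∈ X', c v ≤ 5 * r := (Finset.sum_le_sum_of_subset hX'XZ).trans hXZ5
      have hB'W : B' ⊆ β X' := hB' ▸ hβ.anti hXZ5 hX'XZ
      have hW : ∀ w ∈ β X', w ∈ β X ∧ w ∉ Y := by
        obtain ⟨x, hx⟩ := hB'c.1
        refine (hβ.conn X' hX'5).prop (fun w => w ∈ β X ∧ w ∉ Y) (hB'W hx)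
          ⟨hB's hx, fun h => (Finset.mem_sdiff.1 (hYs h)).2 hx⟩ ?_
        rintro a ha b hb hab ⟨haX, haY⟩
        have hbX' : b ∉ X' := Finset.disjoint_left.1 (hβ.disj X' hX'5) hb
        have hbX : b ∉ X := by
          intro hbX
          by_cases hbK : b ∈ K₁
          · exact haY (hY1 b hbK a haX (hs _ _ hab))
          · exact hbX' (hX' ▸ Finset.mem_union_left _ (Finset.mem_sdiff.2 ⟨hbX, hbK⟩))
        refine ⟨hβ.step hs hX5 haX hab hbX, fun hbY => ?_⟩
        by_cases haB : a ∈ B'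
        · have hbB : b ∉ B' := (Finset.mem_sdiff.1 (hYs hbY)).2
          have hbZ : b ∉ X ∪ Z := by
            intro h
            rcases Finset.mem_union.1 h with h | h
            · exact hbX h
            · exact hbX' (hX' ▸ Finset.mem_union_right _ (Finset.mem_inter.2 ⟨h, hbY⟩))
          exact hbB (hB' ▸ hβ.step hs hXZ5 (hB' ▸ haB) hab hbZ)
        · exact haY (hY2 b hbY a haX haB (hs _ _ hab))
      have hne : ∀ L ∈ C, L ≠ K₁ → Disjoint L (K₁ ∪ Y) := fun L hL hLK =>
        Finset.disjoint_union_right.2 ⟨hC.disj L hL K₁ hK₁C hLK, hYC L hL⟩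
      have hadj : ∀ L ∈ C, L ≠ K₁ → ∃ a ∈ L, ∃ b ∈ K₁ ∪ Y, adj a b := fun L hL hLK => by
        obtain ⟨a, ha, b, hb, hab⟩ := hC.adja L hL K₁ hK₁C hLK
        exact ⟨a, ha, b, Finset.mem_union_left _ hb, hab⟩
      have hcard := Finset.card_erase_add_one hK₁C
      have hcard2 := Finset.card_insert_le (K₁ ∪ Y) (C.erase K₁)
      refine ih (insert (K₁ ∪ Y) (C.erase K₁)) X' ?_ (by omega) ?_ ?_ ?_ ?_
      · have h1 : (β X').card + Y.card ≤ (β X).card := by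
          rw [← Finset.card_union_of_disjoint (Finset.disjoint_left.2 fun w hw => (hW w hw).2)]
          exact Finset.card_le_card (Finset.union_subset (fun w hw => (hW w hw).1) hYβ)
        have h2 : X'.card ≤ X.card + Y.card := by
          rw [hX']
          exact (Finset.card_union_le _ _).trans (Nat.add_le_add
            (Finset.card_le_card Finset.sdiff_subset) (Finset.card_le_card Finset.inter_subset_right))
        have h3 := hYne.card_pos
        omega
      · refine ⟨?_, ?_, ?_⟩
        · intro K hK
          rcases Finset.mem_insert.1 hK with rfl | hK
          · exact hconn
          · exact hC.conn K (Finset.mem_of_mem_erase hK)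
        · intro K hK L hL hKL
          rcases Finset.mem_insert.1 hK with rfl | hK <;>
            rcases Finset.mem_insert.1 hL with rfl | hL
          · exact absurd rfl hKL
          · exact (hne L (Finset.mem_of_mem_erase hL) (Finset.ne_of_mem_erase hL)).symm
          · exact hne K (Finset.mem_of_mem_erase hK) (Finset.ne_of_mem_erase hK)
          · exact hC.disj K (Finset.mem_of_mem_erase hK) L (Finset.mem_of_mem_erase hL) hKL
        · intro K hK L hL hKL
          rcases Finset.mem_insert.1 hK with rfl | hK <;>
            rcases Finset.mem_insert.1 hL with rfl | hL
          · exact absurd rfl hKL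
          · obtain ⟨a, ha, b, hb, hab⟩ :=
              hadj L (Finset.mem_of_mem_erase hL) (Finset.ne_of_mem_erase hL)
            exact ⟨b, hb, a, ha, hs _ _ hab⟩
          · exact hadj K (Finset.mem_of_mem_erase hK) (Finset.ne_of_mem_erase hK)
          · exact hC.adja K (Finset.mem_of_mem_erase hK) L (Finset.mem_of_mem_erase hL) hKL
      · intro x hx
        rw [hX'] at hx
        rcases Finset.mem_union.1 hx with hx | hx
        · obtain ⟨hxX, hxK⟩ := Finset.mem_sdiff.1 hx
          obtain ⟨L, hL, hxL⟩ := hXC x hxX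
          exact ⟨L, Finset.mem_insert_of_mem (Finset.mem_erase.2 ⟨fun h => hxK (h ▸ hxL), hL⟩), hxL⟩
        · exact ⟨_, Finset.mem_insert_self _ _,
            Finset.mem_union_right _ (Finset.mem_inter.1 hx).2⟩
      · intro K hK
        rcases Finset.mem_insert.1 hK with rfl | hK
        · refine (Finset.sum_le_sum_of_subset ?_).trans hZr
          intro x hx
          obtain ⟨hx1, hx2⟩ := Finset.mem_inter.1 hx
          rw [hX'] at hx1
          rcases Finset.mem_union.1 hx1 with h | h
          · obtain ⟨h3, h4⟩ := Finset.mem_sdiff.1 h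
            rcases Finset.mem_union.1 hx2 with h5 | h5
            · exact absurd h5 h4
            · exact absurd h3 (hYX x h5)
          · exact (Finset.mem_inter.1 h).1
        · refine (Finset.sum_le_sum_of_subset ?_).trans (hXr K (Finset.mem_of_mem_erase hK))
          intro x hx
          obtain ⟨hx1, hx2⟩ := Finset.mem_inter.1 hx
          rw [hX'] at hx1
          rcases Finset.mem_union.1 hx1 with h | h
          · exact Finset.mem_inter.2 ⟨(Finset.mem_sdiff.1 h).1, hx2⟩
          · exact absurd (Finset.mem_inter.1 h).2
              (Finset.disjoint_left.1 (hYC K (Finset.mem_of_mem_erase hK)) hx2)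
      · intro K hK
        rcases Finset.mem_insert.1 hK with rfl | hK
        · rw [Finset.disjoint_left]
          intro x hx hxW
          rcases Finset.mem_union.1 hx with h | h
          · exact Finset.disjoint_left.1 (hCβ K₁ hK₁C) h (hW x hxW).1
          · exact (hW x hxW).2 h
        · exact (hCβ K (Finset.mem_of_mem_erase hK)).mono_right fun w hw => (hW w hw).1

theorem haven_five (hs : ∀ a b, adj a b → adj b a) (c : P → ℕ) (N r : ℕ)
    (hN : ∀ B : Finset P, ∑ v ∈ B, c v ^ 2 ≤ N) (hr : 3 * N < (r + 1) ^ 2)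
    (β : Finset P → Finset P) (hβ : IsHaven adj c (5 * r) β) :
    ∃ K : Fin 5 → Finset P, (∀ i, Conn adj (K i)) ∧ (∀ i j, i ≠ j → Disjoint (K i) (K j)) ∧
      ∀ i j, i ≠ j → ∃ a ∈ K i, ∃ b ∈ K j, adj a b := by
  obtain ⟨C, h5, hC⟩ := haven_covey hs c N r hN hr β hβ
  let e := (C.equivFinOfCardEq h5).symm
  have hinj : ∀ i j, i ≠ j → (e i : Finset P) ≠ e j := fun i j hij h =>
    hij (e.injective (Subtype.ext h))
  exact ⟨fun i => (e i : Finset P), fun i => hC.conn _ (e i).2,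
    fun i j hij => hC.disj _ (e i).2 _ (e j).2 (hinj i j hij),
    fun i j hij => hC.adja _ (e i).2 _ (e j).2 (hinj i j hij)⟩

end Haven


/-! ### The planarisation -/

namespace TopMultigraph
open Classical

variable (G : TopMultigraph) (Q : Finset (ℝ × ℝ))

/-- Consecutive points of `Q` on the arc `e`. -/
def Seg (e : G.ι) (s t : unitInterval) : Prop :=
  s < t ∧ G.arc e s ∈ Q ∧ G.arc e t ∈ Q ∧ ∀ u, s < u → u < t → G.arc e u ∉ Q

/-- Adjacency in the planarisation. -/
def padj (p q : ℝ × ℝ) : Prop :=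
  ∃ e s t, G.Seg Q e s t ∧ ((p = G.arc e s ∧ q = G.arc e t) ∨ (p = G.arc e t ∧ q = G.arc e s))

/-- The plane set realising a set of vertices of the planarisation. -/
def real (K : Finset (ℝ × ℝ)) : Set (ℝ × ℝ) :=
  {z | z ∈ K ∨ ∃ e s t, G.Seg Q e s t ∧ G.arc e s ∈ K ∧ G.arc e t ∈ K ∧ z ∈ G.arc e '' Icc s t}

/-- `Q` contains all vertices and all common points of distinct arcs. -/
structure IsPts : Prop where
  V_sub : G.V ⊆ Q
  inter : ∀ e f z, e ≠ f → z ∈ range (G.arc e) → z ∈ range (G.arc f) → z ∈ Q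

variable {G Q}

lemma padj_symm (p q : ℝ × ℝ) (h : G.padj Q p q) : G.padj Q q p := by
  obtain ⟨e, s, t, h, h' | h'⟩ := h
  · exact ⟨e, s, t, h, Or.inr ⟨h'.2, h'.1⟩⟩
  · exact ⟨e, s, t, h, Or.inl ⟨h'.2, h'.1⟩⟩

lemma padj_mem {p q : ℝ × ℝ} (h : G.padj Q p q) : p ∈ Q ∧ q ∈ Q := by
  obtain ⟨e, s, t, h, ⟨rfl, rfl⟩ | ⟨rfl, rfl⟩⟩ := h
  · exact ⟨h.2.1, h.2.2.1⟩
  · exact ⟨h.2.2.1, h.2.1⟩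

lemma conn_sub {K : Finset (ℝ × ℝ)} (hK : Conn (G.padj Q) K) {x : ℝ × ℝ} (hx : x ∈ K)
    (hxQ : x ∈ Q) : K ⊆ Q :=
  fun y hy => hK.prop (fun z => z ∈ Q) hx hxQ (fun _ _ _ _ h _ => (padj_mem h).2) y hy

lemma real_of_mem {K : Finset (ℝ × ℝ)} {z : ℝ × ℝ} (hz : z ∈ K) : z ∈ G.real Q K := Or.inl hz

lemma real_mem_Q {K : Finset (ℝ × ℝ)} {z : ℝ × ℝ} (hz : z ∈ G.real Q K) (hzQ : z ∈ Q) :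
    z ∈ K := by
  rcases hz with h | ⟨e, s, t, hst, hs, ht, u, ⟨hu1, hu2⟩, rfl⟩
  · exact h
  · rcases hu1.eq_or_lt with rfl | h1
    · exact hs
    rcases hu2.eq_or_lt with rfl | h2
    · exact ht
    exact absurd hzQ (hst.2.2.2 u h1 h2)

lemma real_disjoint (hQ : G.IsPts Q) {K L : Finset (ℝ × ℝ)} (hK : K ⊆ Q) (hL : L ⊆ Q)
    (hKL : Disjoint K L) : Disjoint (G.real Q K) (G.real Q L) := by
  rw [Set.disjoint_left]
  intro z hzK hzL
  by_cases hzQ : z ∈ Q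
  · exact Finset.disjoint_left.1 hKL (real_mem_Q hzK hzQ) (real_mem_Q hzL hzQ)
  rcases hzK with h | ⟨e, s, t, hst, hs, ht, u, ⟨hu1, hu2⟩, rfl⟩
  · exact hzQ (hK h)
  rcases hzL with h | ⟨e', s', t', hst', hs', ht', u', ⟨hu1', hu2'⟩, hu⟩
  · exact hzQ (hL h)
  have hee : e' = e := by
    by_contra hne
    exact hzQ (hQ.inter e' e _ hne ⟨u', hu⟩ ⟨u, rfl⟩)
  subst hee
  have huu := G.injective_arc _ hu
  subst huu
  have h1 : s < u' := lt_of_le_of_ne hu1 fun h => hzQ (h ▸ hst.2.1)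
  have h1' : s' < u' := lt_of_le_of_ne hu1' fun h => hzQ (h ▸ hst'.2.1)
  have h2 : u' < t := lt_of_le_of_ne hu2 fun h => hzQ (h ▸ hst.2.2.1)
  have h2' : u' < t' := lt_of_le_of_ne hu2' fun h => hzQ (h ▸ hst'.2.2.1)
  have hss : s = s' := by
    rcases lt_trichotomy s s' with h | h | h
    · exact absurd hst'.2.1 (hst.2.2.2 s' h (h1'.trans h2))
    · exact h
    · exact absurd hst.2.1 (hst'.2.2.2 s h (h1.trans h2'))
  subst hss
  exact Finset.disjoint_left.1 hKL hs hs'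

lemma finite_pre (e : G.ι) : {u : unitInterval | G.arc e u ∈ Q}.Finite :=
  Finite.preimage (G.injective_arc e).injOn Q.finite_toSet

lemma real_compact (K : Finset (ℝ × ℝ)) : IsCompact (G.real Q K) := by
  have h1 : G.real Q K = (K : Set (ℝ × ℝ)) ∪ ⋃ x ∈ {x : G.ι × unitInterval × unitInterval |
      G.Seg Q x.1 x.2.1 x.2.2 ∧ G.arc x.1 x.2.1 ∈ K ∧ G.arc x.1 x.2.2 ∈ K},
      G.arc x.1 '' Icc x.2.1 x.2.2 := by
    ext z
    simp only [real, mem_ofPred_eq, mem_union, Finset.mem_coe, mem_iUnion, exists_prop,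
      Prod.exists, and_assoc]
  rw [h1]
  refine K.finite_toSet.isCompact.union (Finite.isCompact_biUnion ?_ fun x _ =>
    isCompact_Icc.image (G.continuous_arc _))
  refine Finite.subset (s := ⋃ e : G.ι, {e} ×ˢ ({u : unitInterval | G.arc e u ∈ Q} ×ˢ
    {u : unitInterval | G.arc e u ∈ Q})) (finite_iUnion fun e => (finite_singleton e).prod
    ((finite_pre e).prod (finite_pre e))) ?_
  rintro ⟨e, s, t⟩ ⟨h, -⟩
  exact mem_iUnion.2 ⟨e, rfl, h.2.1, h.2.2.1⟩

lemma seg_path (e : G.ι) {s t : unitInterval} (hst : s ≤ t) :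
    IsPathConnected (G.arc e '' Icc s t) := by
  have : G.arc e '' Icc s t = (G.arc e ∘ projIcc 0 1 zero_le_one) '' Icc (s : ℝ) t := by
    ext z
    constructor
    · rintro ⟨u, hu, rfl⟩
      exact ⟨u, ⟨hu.1, hu.2⟩, by simp⟩
    · rintro ⟨u, hu, rfl⟩
      have hu' : u ∈ Icc (0 : ℝ) 1 := ⟨s.2.1.trans hu.1, hu.2.trans t.2.2⟩
      refine ⟨⟨u, hu'⟩, ⟨hu.1, hu.2⟩, by simp [projIcc_of_mem zero_le_one hu']⟩
  rw [this]
  exact ((convex_Icc _ _).isPathConnected ⟨(s : ℝ), le_rfl, hst⟩).image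
    ((G.continuous_arc e).comp continuous_projIcc)

lemma real_path {K : Finset (ℝ × ℝ)} (hK : Conn (G.padj Q) K) :
    IsPathConnected (G.real Q K) := by
  obtain ⟨x, hx⟩ := hK.1
  have hseg : ∀ e s t, G.Seg Q e s t → G.arc e s ∈ K → G.arc e t ∈ K → ∀ u ∈ Icc s t,
      JoinedIn (G.real Q K) (G.arc e s) (G.arc e u) := by
    intro e s t h hs ht u hu
    exact ((seg_path e h.1.le).joinedIn _ ⟨s, ⟨le_rfl, h.1.le⟩, rfl⟩ _ ⟨u, hu, rfl⟩).mono
      fun z hz => Or.inr ⟨e, s, t, h, hs, ht, hz⟩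
  have hall : ∀ y ∈ K, JoinedIn (G.real Q K) x y := by
    refine hK.prop (fun y => JoinedIn (G.real Q K) x y) hx (JoinedIn.refl (Or.inl hx)) ?_
    rintro a ha b hb ⟨e, s, t, h, ⟨rfl, rfl⟩ | ⟨rfl, rfl⟩⟩ hj
    · exact hj.trans (hseg e s t h ha hb t ⟨h.1.le, le_rfl⟩)
    · exact hj.trans (hseg e s t h hb ha t ⟨h.1.le, le_rfl⟩).symm
  refine ⟨x, Or.inl hx, fun {y} hy => ?_⟩
  rcases hy with hy | ⟨e, s, t, h, hs, ht, u, hu, rfl⟩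
  · exact hall y hy
  · exact (hall _ hs).trans (hseg e s t h hs ht u hu)

/-- The planarisation has no `K₅` minor. -/
lemma no_five (hQ : G.IsPts Q) (K : Fin 5 → Finset (ℝ × ℝ)) (hc : ∀ i, Conn (G.padj Q) (K i))
    (hd : ∀ i j, i ≠ j → Disjoint (K i) (K j))
    (ha : ∀ i j, i ≠ j → ∃ a ∈ K i, ∃ b ∈ K j, G.padj Q a b) : False := by
  have hsub : ∀ i, K i ⊆ Q := by
    intro i
    obtain ⟨j, hj⟩ : ∃ j : Fin 5, i ≠ j := by revert i; decide
    obtain ⟨a, haK, b, hb, hab⟩ := ha i j hj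
    exact conn_sub (hc i) haK (padj_mem hab).1
  choose x hx using fun i => (hc i).1
  have hγ : ∀ i j, ∃ γ : ℝ → ℝ × ℝ, i ≠ j → Continuous γ ∧ γ 0 = x i ∧ γ 1 = x j ∧
      ∀ s, γ s ∈ G.real Q (K i ∪ K j) := by
    intro i j
    by_cases hij : i = j
    · exact ⟨0, fun h => absurd hij h⟩
    obtain ⟨a, haK, b, hb, hab⟩ := ha i j hij
    have hp := real_path (conn_union_adj padj_symm (hc i) (hc j) haK hb hab)
    obtain ⟨γ, hγ⟩ := hp.joinedIn (x i) (Or.inl (Finset.mem_union_left _ (hx i)))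
      (x j) (Or.inl (Finset.mem_union_right _ (hx j)))
    refine ⟨γ.extend, fun _ => ⟨γ.continuous_extend, γ.extend_zero, γ.extend_one, fun s => ?_⟩⟩
    have := Path.extend_range γ
    obtain ⟨t, ht⟩ : γ.extend s ∈ range γ := this ▸ mem_range_self s
    rw [← ht]; exact hγ t
  choose γ hγ using hγ
  refine no_k5 (fun i => cx (x i)) (fun i j s => cx (γ i j s))
    (fun i j h => continuous_cx.comp (hγ i j h).1) (fun i j h => by rw [(hγ i j h).2.1])
    (fun i j h => by rw [(hγ i j h).2.2.1]) ?_
  intro i j k l hij hik hil hjk hjl hkl s t heq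
  have h1 := (hγ i j hij).2.2.2 s
  have h2 := (hγ k l hkl).2.2.2 t
  rw [cx_inj heq] at h1
  refine Set.disjoint_left.1 (real_disjoint hQ (Finset.union_subset (hsub i) (hsub j))
    (Finset.union_subset (hsub k) (hsub l)) ?_) h1 h2
  rw [Finset.disjoint_union_left, Finset.disjoint_union_right, Finset.disjoint_union_right]
  exact ⟨⟨hd _ _ hik, hd _ _ hil⟩, hd _ _ hjk, hd _ _ hjl⟩

lemma comp_step {F : Finset (ℝ × ℝ)} {v a b : ℝ × ℝ} (ha : a ∈ comp (G.padj Q) F v)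
    (hb : b ∈ F) (hab : G.padj Q a b) : b ∈ comp (G.padj Q) F v := by
  refine comp_max (conn_pair padj_symm hab) ?_ (x := a) (by simp) ha (by simp)
  intro z hz
  simp only [Finset.mem_insert, Finset.mem_singleton] at hz
  rcases hz with rfl | rfl
  · exact comp_subset _ _ ha
  · exact hb

lemma edge_real (hQ : G.IsPts Q) (S : Finset (ℝ × ℝ)) (e : G.ι)
    (he : ∀ p ∈ S, p ∈ Q → p ∉ range (G.arc e)) :
    range (G.arc e) ⊆ G.real Q (comp (G.padj Q) (Q \ S) (G.arc e 0)) := by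
  set K := comp (G.padj Q) (Q \ S) (G.arc e 0) with hK
  have hF : ∀ u, G.arc e u ∈ Q → G.arc e u ∈ Q \ S := fun u hu =>
    Finset.mem_sdiff.2 ⟨hu, fun h => he _ h hu ⟨u, rfl⟩⟩
  have h0Q : G.arc e 0 ∈ Q := hQ.V_sub (G.source_mem e)
  have h1Q : G.arc e 1 ∈ Q := hQ.V_sub (G.target_mem e)
  have hfin : ∀ p : unitInterval → Prop, {w | G.arc e w ∈ Q ∧ p w}.Finite := fun p =>
    (finite_pre (Q := Q) e).subset fun w hw => hw.1
  -- predecessor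
  have hpre : ∀ u, 0 < u → ∃ s, s < u ∧ G.arc e s ∈ Q ∧ ∀ w, s < w → w < u → G.arc e w ∉ Q := by
    intro u hu
    obtain ⟨s, hs, hmax⟩ := (hfin fun w => w < u).exists_maximalFor id _ ⟨0, h0Q, hu⟩
    exact ⟨s, hs.2, hs.1, fun w hw1 hw2 hw => absurd (hmax ⟨hw, hw2⟩ hw1.le) (not_le.2 hw1)⟩
  have hsuc : ∀ u, u < 1 → ∃ t, u < t ∧ G.arc e t ∈ Q ∧ ∀ w, u < w → w < t → G.arc e w ∉ Q := by
    intro u hu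
    obtain ⟨s, hs, hmax⟩ := (hfin fun w => u < w).exists_minimalFor id _ ⟨1, h1Q, hu⟩
    exact ⟨s, hs.2, hs.1, fun w hw1 hw2 hw => absurd (hmax ⟨hw, hw1⟩ hw2.le) (not_le.2 hw2)⟩
  have hgood : ∀ u, G.arc e u ∈ Q → G.arc e u ∈ K := by
    by_contra hcon
    push Not at hcon
    obtain ⟨u₀, hu₀⟩ := hcon
    obtain ⟨u, hu, hmin⟩ := (hfin fun w => G.arc e w ∉ K).exists_minimalFor id _
      ⟨u₀, hu₀⟩
    have hu0 : 0 < u := by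
      refine lt_of_le_of_ne bot_le ?_
      rintro rfl
      exact hu.2 (mem_comp_self (hF _ hu.1))
    obtain ⟨s, hsu, hsQ, hs⟩ := hpre u hu0
    have hsK : G.arc e s ∈ K := by
      by_contra h
      exact absurd (hmin ⟨hsQ, h⟩ hsu.le) (not_le.2 hsu)
    exact hu.2 (comp_step hsK (hF u hu.1) ⟨e, s, u, ⟨hsu, hsQ, hu.1, hs⟩, Or.inl ⟨rfl, rfl⟩⟩)
  rintro _ ⟨u, rfl⟩
  by_cases huQ : G.arc e u ∈ Q
  · exact Or.inl (hgood u huQ)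
  have hu0 : 0 < u := lt_of_le_of_ne bot_le fun h => huQ (h ▸ h0Q)
  have hu1 : u < 1 := lt_of_le_of_ne le_top fun h => huQ (h ▸ h1Q)
  obtain ⟨s, hsu, hsQ, hs⟩ := hpre u hu0
  obtain ⟨t, hut, htQ, ht⟩ := hsuc u hu1
  refine Or.inr ⟨e, s, t, ⟨hsu.trans hut, hsQ, htQ, fun w h1 h2 => ?_⟩, hgood s hsQ, hgood t htQ,
    u, ⟨hsu.le, hut.le⟩, rfl⟩
  rcases lt_trichotomy w u with h | rfl | h
  · exact hs w h1 h
  · exact huQ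
  · exact ht w h h2

end TopMultigraph


namespace TopMultigraph
open Classical

variable (G : TopMultigraph)

/-- Edges through a point. -/
noncomputable def thru (p : ℝ × ℝ) : Finset G.ι := Finset.univ.filter fun e => p ∈ range (G.arc e)

/-- The crossing points. -/
def crossPts : Set (ℝ × ℝ) :=
  {p | ∃ x : G.ι × G.ι, x.1 ≠ x.2 ∧ p ∈ G.arcInterior x.1 ∩ G.arcInterior x.2}

variable {G}

lemma crossPts_finite (hsc : G.SingleCrossing) : G.crossPts.Finite := by
  have : G.crossPts = ⋃ x ∈ {x : G.ι × G.ι | x.1 ≠ x.2}, G.arcInterior x.1 ∩ G.arcInterior x.2 := by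
    ext p; simp only [crossPts, mem_ofPred_eq, mem_iUnion, exists_prop]
  rw [this]
  exact (toFinite _).biUnion fun x hx => (hsc x.1 x.2 hx).finite

lemma exists_pts (hsc : G.SingleCrossing) : ∃ Q : Finset (ℝ × ℝ), G.IsPts Q ∧
    ∀ p ∈ Q, p ∈ G.V ∨ p ∈ G.crossPts := by
  refine ⟨G.V ∪ (crossPts_finite hsc).toFinset, ⟨Finset.subset_union_left, ?_⟩, ?_⟩
  · intro e f z hef he hf
    rw [Finset.mem_union, Finite.mem_toFinset]
    rcases arc_cases e he with h1 | h1
    · exact Or.inl (endpoints_subset_V e h1)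
    rcases arc_cases f hf with h2 | h2
    · exact Or.inl (endpoints_subset_V f h2)
    exact Or.inr ⟨(e, f), hef, h1, h2⟩
  · intro p hp
    rwa [Finset.mem_union, Finite.mem_toFinset] at hp

lemma thru_V {v : ℝ × ℝ} (hv : v ∈ G.V) : (G.thru v).card = G.degree v := by
  unfold degree thru
  rw [Nat.card_eq_fintype_card, Fintype.card_subtype]
  congr 1
  ext e
  simp only [Finset.mem_filter, Finset.mem_univ, true_and]
  exact ⟨fun h => range_inter_V e h hv, fun h => endpoints_subset_range e h⟩

lemma cross_cost (hsc : G.SingleCrossing) (B : Finset (ℝ × ℝ)) (hB : ∀ p ∈ B, p ∉ G.V)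
    (hB' : ∀ p ∈ B, p ∈ G.crossPts) : ∑ p ∈ B, (G.thru p).card ^ 2 ≤ 4 * G.crossingNumber := by
  have hinr : ∀ p ∈ B, ∀ e ∈ G.thru p, p ∈ G.arcInterior e := fun p hp e he =>
    (arc_cases e (Finset.mem_filter.1 he).2).resolve_left fun h => hB p hp (endpoints_subset_V e h)
  have h1 : ∑ p ∈ B, (G.thru p).offDiag.card ≤ 2 * G.crossingNumber := by
    rw [← Finset.card_biUnion]
    · refine le_trans ?_ (crossPairs_ncard (G := G))
      rw [← ncard_coe_finset]
      refine ncard_le_ncard ?_ (toFinite _)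
      intro x hx
      obtain ⟨p, hp, hx⟩ := Finset.mem_biUnion.1 hx
      obtain ⟨h1, h2, h3⟩ := Finset.mem_offDiag.1 hx
      exact ⟨h3, p, hinr p hp _ h1, hinr p hp _ h2⟩
    · intro p hp q hq hpq
      rw [Function.onFun, Finset.disjoint_left]
      intro x hx hx'
      obtain ⟨h1, h2, h3⟩ := Finset.mem_offDiag.1 hx
      obtain ⟨h1', h2', h3'⟩ := Finset.mem_offDiag.1 hx'
      exact hpq (hsc _ _ h3 ⟨hinr p hp _ h1, hinr p hp _ h2⟩ ⟨hinr q hq _ h1', hinr q hq _ h2'⟩)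
  have h2 : ∑ p ∈ B, (G.thru p).card ^ 2 ≤ ∑ p ∈ B, 2 * (G.thru p).offDiag.card := by
    refine Finset.sum_le_sum fun p hp => ?_
    obtain ⟨⟨e, f⟩, hef, hpe, hpf⟩ := hB' p hp
    have h2 : 2 ≤ (G.thru p).card := by
      rw [← Finset.card_pair hef]
      refine Finset.card_le_card ?_
      intro x hx
      simp only [Finset.mem_insert, Finset.mem_singleton] at hx
      rcases hx with rfl | rfl
      · exact Finset.mem_filter.2 ⟨Finset.mem_univ _, arcInterior_subset _ hpe⟩
      · exact Finset.mem_filter.2 ⟨Finset.mem_univ _, arcInterior_subset _ hpf⟩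
    rw [Finset.offDiag_card]
    obtain ⟨t, ht⟩ : ∃ t, (G.thru p).card = t + 2 := ⟨_, (Nat.sub_add_cancel h2).symm⟩
    rw [ht]
    have : (t + 2) * (t + 2) - (t + 2) = (t + 2) * (t + 1) := by
      rw [Nat.sub_eq_iff_eq_add (by nlinarith)]; ring
    rw [this]
    nlinarith
  rw [← Finset.mul_sum] at h2
  omega

/-- The cost function. -/
noncomputable def cost (G : TopMultigraph) (Q : Finset (ℝ × ℝ)) (p : ℝ × ℝ) : ℕ :=
  if p ∈ Q then (G.thru p).card else 0

lemma cost_sq (hsc : G.SingleCrossing) {Q : Finset (ℝ × ℝ)}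
    (hQ' : ∀ p ∈ Q, p ∈ G.V ∨ p ∈ G.crossPts) (B : Finset (ℝ × ℝ)) :
    ∑ p ∈ B, G.cost Q p ^ 2 ≤ ∑ v ∈ G.V, G.degree v ^ 2 + 4 * G.crossingNumber := by
  have h1 : ∑ p ∈ B, G.cost Q p ^ 2 ≤ ∑ p ∈ Q, (G.thru p).card ^ 2 := by
    calc ∑ p ∈ B, G.cost Q p ^ 2 = ∑ p ∈ B, if p ∈ Q then (G.thru p).card ^ 2 else 0 := by
          refine Finset.sum_congr rfl fun p _ => ?_
          unfold cost; split_ifs <;> simp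
      _ = ∑ p ∈ B.filter (· ∈ Q), (G.thru p).card ^ 2 := (Finset.sum_filter _ _).symm
      _ ≤ _ := Finset.sum_le_sum_of_subset fun p hp => (Finset.mem_filter.1 hp).2
  have h2 := Finset.sum_filter_add_sum_filter_not Q (· ∈ G.V) (fun p => (G.thru p).card ^ 2)
  have h3 : ∑ p ∈ Q.filter (· ∈ G.V), (G.thru p).card ^ 2 ≤ ∑ v ∈ G.V, G.degree v ^ 2 := by
    calc _ ≤ ∑ v ∈ G.V, (G.thru v).card ^ 2 :=
          Finset.sum_le_sum_of_subset fun p hp => (Finset.mem_filter.1 hp).2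
      _ = _ := Finset.sum_congr rfl fun v hv => by rw [thru_V hv]
  have h4 := cross_cost hsc (Q.filter fun p => p ∉ G.V) (fun p hp => (Finset.mem_filter.1 hp).2)
    (fun p hp => (hQ' p (Finset.mem_filter.1 hp).1).resolve_left (Finset.mem_filter.1 hp).2)
  omega

/-- Edges meeting a set of points of the planarisation. -/
def meet (G : TopMultigraph) (Q S : Finset (ℝ × ℝ)) : Set G.ι :=
  {e | ∃ p ∈ S, p ∈ Q ∧ p ∈ range (G.arc e)}

lemma meet_card (Q S : Finset (ℝ × ℝ)) : (G.meet Q S).ncard ≤ ∑ p ∈ S, G.cost Q p := by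
  have h : G.meet Q S ⊆ ((S.filter (· ∈ Q)).biUnion G.thru : Finset G.ι) := by
    rintro e ⟨p, hp, hpQ, he⟩
    exact Finset.mem_coe.2 (Finset.mem_biUnion.2 ⟨p, Finset.mem_filter.2 ⟨hp, hpQ⟩,
      Finset.mem_filter.2 ⟨Finset.mem_univ _, he⟩⟩)
  calc (G.meet Q S).ncard ≤ _ := ncard_le_ncard h (Finset.finite_toSet _)
    _ = ((S.filter (· ∈ Q)).biUnion G.thru).card := ncard_coe_finset _
    _ ≤ ∑ p ∈ S.filter (· ∈ Q), (G.thru p).card := Finset.card_biUnion_le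
    _ = ∑ p ∈ S, G.cost Q p := by rw [Finset.sum_filter]; rfl

end TopMultigraph


namespace TopMultigraph
open Classical

variable {G : TopMultigraph} {Q : Finset (ℝ × ℝ)}

/-- Every face of the complement contains fewer than a fifth of the vertices. -/
def Central (G : TopMultigraph) (A : Set (ℝ × ℝ)) : Prop :=
  ∀ x, x ∉ A → 5 * (G.V.filter (fun v => v ∈ connectedComponentIn Aᶜ x)).card < G.V.card

lemma not_central_singleton (hn : 2 ≤ G.V.card) (s : ℝ × ℝ) : ¬ G.Central {s} := by
  intro h
  have hc := isConnected_compl_singleton_of_one_lt_rank plane_rank s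
  obtain ⟨x, hx⟩ := hc.1
  have h1 := h x hx
  have h2 : G.V.erase s ⊆ G.V.filter (fun v => v ∈ connectedComponentIn ({s} : Set (ℝ × ℝ))ᶜ x) := by
    intro v hv
    obtain ⟨hvs, hvV⟩ := Finset.mem_erase.1 hv
    exact Finset.mem_filter.2 ⟨hvV, hc.isPreconnected.subset_connectedComponentIn hx
      (Subset.refl _) hvs⟩
  have h3 := Finset.card_le_card h2
  have h4 := Finset.pred_card_le_card_erase (s := G.V) (a := s)
  omega

lemma central_touch (hn : 1 ≤ G.V.card) {A A' : Set (ℝ × ℝ)} (hA : IsClosed A)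
    (hAp : IsPreconnected A) (hAn : A.Nonempty) (hAp' : IsPreconnected A')
    (hAn' : A'.Nonempty) (hd : Disjoint A A') (hc : G.Central A) (hc' : G.Central A') : False := by
  obtain ⟨y, hy⟩ := hAn
  obtain ⟨x, hx⟩ := hAn'
  have hxA : x ∉ A := fun h => Set.disjoint_left.1 hd h hx
  have hyA' : y ∉ A' := fun h => Set.disjoint_left.1 hd hy h
  have hsub : A' ⊆ connectedComponentIn Aᶜ x :=
    hAp'.subset_connectedComponentIn hx fun z hz hzA => Set.disjoint_left.1 hd hzA hz
  have hpre := face_compl_preconnected hA hAp ⟨y, hy⟩ x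
  have hsub' : (connectedComponentIn Aᶜ x)ᶜ ⊆ connectedComponentIn A'ᶜ y :=
    hpre.subset_connectedComponentIn (fun h => connectedComponentIn_subset _ _ h hy)
      (compl_subset_compl.2 hsub)
  have h1 := hc x hxA
  have h2 := hc' y hyA'
  have h3 : G.V ⊆ G.V.filter (fun v => v ∈ connectedComponentIn Aᶜ x) ∪
      G.V.filter (fun v => v ∈ connectedComponentIn A'ᶜ y) := by
    intro v hv
    rw [Finset.mem_union, Finset.mem_filter, Finset.mem_filter]
    by_cases h : v ∈ connectedComponentIn Aᶜ x
    · exact Or.inl ⟨hv, h⟩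
    · exact Or.inr ⟨hv, hsub' h⟩
  have h4 := (Finset.card_le_card h3).trans (Finset.card_union_le _ _)
  omega

lemma real_singleton (s : ℝ × ℝ) : G.real Q {s} = {s} := by
  ext z
  constructor
  · rintro (h | ⟨e, a, b, hab, h1, h2, -⟩)
    · simpa using h
    · exfalso
      rw [Finset.mem_singleton] at h1 h2
      exact hab.1.ne (G.injective_arc e (h1.trans h2.symm))
  · rintro rfl
    exact Or.inl (by simp)

/-- The components of the planarisation minus `S`, together with the points of `S`. -/
noncomputable def parts (G : TopMultigraph) (Q S : Finset (ℝ × ℝ)) : Finset (Finset (ℝ × ℝ)) :=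
  (Q \ S).image (comp (G.padj Q) (Q \ S)) ∪ (Q ∩ S).image fun s => {s}

lemma parts_conn {S K : Finset (ℝ × ℝ)} (hK : K ∈ G.parts Q S) : Conn (G.padj Q) K ∧ K ⊆ Q := by
  rcases Finset.mem_union.1 hK with h | h
  · obtain ⟨v, hv, rfl⟩ := Finset.mem_image.1 h
    exact ⟨comp_conn hv, (comp_subset _ _).trans Finset.sdiff_subset⟩
  · obtain ⟨v, hv, rfl⟩ := Finset.mem_image.1 h
    exact ⟨conn_singleton v, by simpa using (Finset.mem_inter.1 hv).1⟩

lemma parts_disj {S K L : Finset (ℝ × ℝ)} (hK : K ∈ G.parts Q S) (hL : L ∈ G.parts Q S)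
    (hKL : K ≠ L) : Disjoint K L := by
  rw [Finset.disjoint_left]
  intro z hzK hzL
  apply hKL
  rcases Finset.mem_union.1 hK with h | h <;> rcases Finset.mem_union.1 hL with h' | h' <;>
    obtain ⟨v, hv, rfl⟩ := Finset.mem_image.1 h <;> obtain ⟨w, hw, rfl⟩ := Finset.mem_image.1 h'
  · exact Finset.Subset.antisymm (comp_max (comp_conn hv) (comp_subset _ _) hzK hzL)
      (comp_max (comp_conn hw) (comp_subset _ _) hzL hzK)
  · rw [Finset.mem_singleton] at hzL
    subst hzL
    exact absurd (Finset.mem_inter.1 hw).2 (Finset.mem_sdiff.1 (comp_subset _ _ hzK)).2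
  · rw [Finset.mem_singleton] at hzK
    subst hzK
    exact absurd (Finset.mem_inter.1 hv).2 (Finset.mem_sdiff.1 (comp_subset _ _ hzL)).2
  · rw [Finset.mem_singleton] at hzK hzL
    rw [← hzK, ← hzL]

lemma cut_or_central' (hsc : G.SingleCrossing) (hsep : G.Separated) (hn : 2 ≤ G.V.card)
    (hQ : G.IsPts Q) (S : Finset (ℝ × ℝ)) :
    (∃ k₁ k₂ : ℕ, k₁ * (k₁ - 1) ≤ 2 * G.crossingNumber ∧ k₂ * (k₂ - 1) ≤ 2 * G.crossingNumber ∧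
      G.bisectionWidth ≤ (G.meet Q S).ncard + k₁ + k₂) ∨
    ∃ v ∈ Q \ S, G.Central (G.real Q (comp (G.padj Q) (Q \ S) v)) := by
  have hcomp : ∀ v ∈ Q \ S, comp (G.padj Q) (Q \ S) v ∈ G.parts Q S := fun v hv =>
    Finset.mem_union_left _ (Finset.mem_image_of_mem _ hv)
  rcases cut_or_central hsc hsep (by omega) (G.meet Q S) (κ := {K // K ∈ G.parts Q S})
    (fun K => G.real Q K.1) (fun K => (real_compact K.1).isClosed)
    (fun K => (real_path (parts_conn K.2).1).isConnected.isPreconnected)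
    (fun K => (real_path (parts_conn K.2).1).nonempty)
    (fun K L hKL => real_disjoint hQ (parts_conn K.2).2 (parts_conn L.2).2
      (parts_disj K.2 L.2 fun h => hKL (Subtype.ext h)))
    (fun v hv => by
      have hvQ := hQ.V_sub hv
      by_cases hvS : v ∈ S
      · exact ⟨⟨{v}, Finset.mem_union_right _ (Finset.mem_image.2
          ⟨v, Finset.mem_inter.2 ⟨hvQ, hvS⟩, rfl⟩)⟩, Or.inl (by simp)⟩
      · have hv' := Finset.mem_sdiff.2 ⟨hvQ, hvS⟩
        exact ⟨⟨_, hcomp v hv'⟩, Or.inl (mem_comp_self hv')⟩)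
    (fun e he => by
      have he' : ∀ p ∈ S, p ∈ Q → p ∉ range (G.arc e) := fun p hp hpQ h => he ⟨p, hp, hpQ, h⟩
      have h0Q : G.arc e 0 ∈ Q := hQ.V_sub (G.source_mem e)
      have h0 : G.arc e 0 ∈ Q \ S := Finset.mem_sdiff.2 ⟨h0Q, fun h => he' _ h h0Q ⟨0, rfl⟩⟩
      exact ⟨⟨_, hcomp _ h0⟩, edge_real hQ S e he'⟩) with h | ⟨⟨K, hK⟩, h⟩
  · exact Or.inl h
  · right
    rcases Finset.mem_union.1 hK with h' | h'
    · obtain ⟨v, hv, rfl⟩ := Finset.mem_image.1 h'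
      exact ⟨v, hv, h⟩
    · obtain ⟨v, hv, rfl⟩ := Finset.mem_image.1 h'
      exfalso
      simp only [real_singleton] at h
      exact not_central_singleton hn v h

theorem exists_cut (hsc : G.SingleCrossing) (hsep : G.Separated) (hn : 2 ≤ G.V.card) (r : ℕ)
    (hr : 3 * (∑ v ∈ G.V, G.degree v ^ 2 + 4 * G.crossingNumber) < (r + 1) ^ 2) :
    ∃ k₁ k₂ : ℕ, k₁ * (k₁ - 1) ≤ 2 * G.crossingNumber ∧ k₂ * (k₂ - 1) ≤ 2 * G.crossingNumber ∧
      G.bisectionWidth ≤ 5 * r + k₁ + k₂ := by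
  obtain ⟨Q, hQ, hQ'⟩ := exists_pts hsc
  by_contra hcon
  have hcen : ∀ S : Finset (ℝ × ℝ), ∑ p ∈ S, G.cost Q p ≤ 5 * r →
      ∃ v ∈ Q \ S, G.Central (G.real Q (comp (G.padj Q) (Q \ S) v)) := by
    intro S hS
    refine (cut_or_central' hsc hsep hn hQ S).resolve_left ?_
    rintro ⟨k₁, k₂, h1, h2, h3⟩
    have := meet_card (G := G) Q S
    exact hcon ⟨k₁, k₂, h1, h2, by omega⟩
  have hex : ∀ S : Finset (ℝ × ℝ), ∃ v, ∑ p ∈ S, G.cost Q p ≤ 5 * r →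
      v ∈ Q \ S ∧ G.Central (G.real Q (comp (G.padj Q) (Q \ S) v)) := by
    intro S
    by_cases hS : ∑ p ∈ S, G.cost Q p ≤ 5 * r
    · obtain ⟨v, hv⟩ := hcen S hS
      exact ⟨v, fun _ => hv⟩
    · exact ⟨0, fun h => absurd h hS⟩
  choose c hc using hex
  have hQS : ∀ S : Finset (ℝ × ℝ), ∀ x ∈ comp (G.padj Q) (Q \ S) (c S), x ∈ Q :=
    fun S x hx => (Finset.mem_sdiff.1 (comp_subset _ _ hx)).1
  obtain ⟨K, h1, h2, h3⟩ := haven_five (adj := G.padj Q) padj_symm (G.cost Q) _ r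
    (cost_sq hsc hQ') hr (fun S => comp (G.padj Q) (Q \ S) (c S))
    { conn := fun S hS => comp_conn (hc S hS).1
      disj := fun S hS => Finset.disjoint_left.2 fun x hx =>
        (Finset.mem_sdiff.1 (comp_subset _ _ hx)).2
      maxi := fun S hS K hK hKS x hxK hx => by
        have hKQ := conn_sub hK hxK (hQS S x hx)
        exact comp_max hK (fun y hy => Finset.mem_sdiff.2
          ⟨hKQ hy, Finset.disjoint_left.1 hKS hy⟩) hxK hx
      touch := fun S S' hS hS' => by
        by_contra hno
        push Not at hno
        have hp := real_path (comp_conn (adj := G.padj Q) (hc S hS).1)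
        have hp' := real_path (comp_conn (adj := G.padj Q) (hc S' hS').1)
        exact central_touch (by omega) (real_compact _).isClosed hp.isConnected.isPreconnected
          hp.nonempty hp'.isConnected.isPreconnected hp'.nonempty
          (real_disjoint hQ (fun x hx => hQS S x hx) (fun x hx => hQS S' x hx)
            (Finset.disjoint_left.2 hno)) (hc S hS).2 (hc S' hS').2 }
  exact no_five hQ K h1 h2 h3

lemma width_small (hn : G.V.card ≤ 1) : G.bisectionWidth = 0 := by
  have hemp : IsEmpty G.ι := ⟨fun e => G.ends_ne e
    (Finset.card_le_one.1 hn _ (G.source_mem e) _ (G.target_mem e))⟩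
  unfold bisectionWidth
  rw [Nat.sInf_eq_zero]
  by_cases h : {b : ℕ | ∃ (D : Set G.ι) (V₁ V₂ : Finset (ℝ × ℝ)) (h₁ : V₁ ⊆ G.V) (h₂ : V₂ ⊆ G.V),
    D.ncard = b ∧ Disjoint V₁ V₂ ∧ V₁ ∪ V₂ = G.V ∧
    (V₁.card : ℝ) ≤ 4 * (G.V.card : ℝ) / 5 ∧ (V₂.card : ℝ) ≤ 4 * (G.V.card : ℝ) / 5 ∧
    (∀ e : G.ι, e ∉ D →
      G.endpoints e ⊆ (V₁ : Set (ℝ × ℝ)) ∨ G.endpoints e ⊆ (V₂ : Set (ℝ × ℝ))) ∧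
    (G.restrict V₁ h₁ D).SingleCrossing ∧ (G.restrict V₁ h₁ D).Separated ∧
    (G.restrict V₂ h₂ D).SingleCrossing ∧ (G.restrict V₂ h₂ D).Separated}.Nonempty
  · left
    obtain ⟨b, hb⟩ := h
    have hb0 : b = 0 := by
      obtain ⟨D, V₁, V₂, h₁, h₂, hD, -⟩ := hb
      rw [← hD, Set.eq_empty_of_isEmpty D, ncard_empty]
    exact hb0 ▸ hb
  · right
    exact Set.not_nonempty_iff_eq_empty.1 h

lemma k_bound {k c : ℕ} {y : ℝ} (hy : 0 ≤ y) (hk : k * (k - 1) ≤ 2 * c) (hc : (c : ℝ) ≤ y ^ 2) :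
    (k : ℝ) ≤ 1 + 1.415 * y := by
  rcases Nat.eq_zero_or_pos k with rfl | hk0
  · push_cast; positivity
  obtain ⟨m, rfl⟩ : ∃ m, k = m + 1 := ⟨k - 1, by omega⟩
  simp only [Nat.add_sub_cancel] at hk
  have h1 : ((m : ℝ) + 1) * m ≤ 2 * c := by exact_mod_cast hk
  push_cast
  have hm : (0 : ℝ) ≤ m := Nat.cast_nonneg m
  have : (m : ℝ) ≤ 1.415 * y := by
    refine abs_le_of_sq_le_sq' ?_ (by positivity) |>.2
    nlinarith
  linarith

end TopMultigraph

open TopMultigraph in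
theorem bisectionWidth_main (G : TopMultigraph) (hsc : G.SingleCrossing) (hsep : G.Separated) :
    (G.bisectionWidth : ℝ) ≤ 22 * Real.sqrt ((G.crossingNumber : ℝ) +
      ∑ v ∈ G.V, (G.degree v : ℝ) ^ 2 + (G.V.card : ℝ)) := by
  rcases Nat.lt_or_ge G.V.card 2 with hn | hn
  · rw [width_small (by omega)]
    push_cast
    positivity
  set N := ∑ v ∈ G.V, G.degree v ^ 2 + 4 * G.crossingNumber with hN
  obtain ⟨k₁, k₂, h1, h2, h3⟩ := exists_cut hsc hsep hn (Nat.sqrt (3 * N))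
    (by rw [sq]; exact Nat.lt_succ_sqrt _)
  set r := Nat.sqrt (3 * N) with hr
  have hrN : r ^ 2 ≤ 3 * N := Nat.sqrt_le' _
  set D : ℝ := ∑ v ∈ G.V, (G.degree v : ℝ) ^ 2 with hD
  have hD0 : 0 ≤ D := Finset.sum_nonneg fun _ _ => sq_nonneg _
  have hND : (N : ℝ) = D + 4 * G.crossingNumber := by rw [hN, hD]; push_cast; ring
  have hc0 : (0 : ℝ) ≤ G.crossingNumber := Nat.cast_nonneg _
  have hn' : (2 : ℝ) ≤ G.V.card := by exact_mod_cast hn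
  set y := Real.sqrt ((G.crossingNumber : ℝ) + D + (G.V.card : ℝ)) with hy
  have hy0 : 0 ≤ y := Real.sqrt_nonneg _
  have hy2 : y ^ 2 = (G.crossingNumber : ℝ) + D + (G.V.card : ℝ) := Real.sq_sqrt (by positivity)
  have hk1 := k_bound hy0 h1 (by linarith)
  have hk2 := k_bound hy0 h2 (by linarith)
  have hrN' : (r : ℝ) ^ 2 ≤ 3 * N := by exact_mod_cast hrN
  have hr' : (r : ℝ) ≤ 3.4645 * y := by
    refine abs_le_of_sq_le_sq' ?_ (by positivity) |>.2
    nlinarith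
  have hy1 : 1.4 ≤ y := by
    refine abs_le_of_sq_le_sq' ?_ hy0 |>.2
    nlinarith
  have h3' : (G.bisectionWidth : ℝ) ≤ 5 * r + k₁ + k₂ := by exact_mod_cast h3
  linarith



/-- **Lemma 4 (bisection width bound).** For a separated single-crossing topological multigraph
`G` with `n` vertices, degree sequence `(d_v)_{v ∈ V}` and `cr(G)` crossings,
`b(G) ≤ 22 √(cr(G) + Σ_v d_v² + n)`. -/
theorem bisectionWidth_le (G : TopMultigraph)
    (hsc : G.SingleCrossing) (hsep : G.Separated) :
    (G.bisectionWidth : ℝ) ≤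
      22 * Real.sqrt ((G.crossingNumber : ℝ) + ∑ v ∈ G.V, (G.degree v : ℝ) ^ 2
        + (G.V.card : ℝ)) :=
  bisectionWidth_main G hsc hsep
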